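/- arXiv:1205.6534 — 11 statements merged into one kernel-verified Lean document; each statement's English description precedes it below -/
import Mathlib

section
/- Let (M, μ) be a probability space and let l ≥ 1. For each i = 1, …, l let d_i ≥ 1 and let e^i_0, …, e^i_{d_i} : M → ℝ be measurable functions forming an orthonormal family in L²(μ) and satisfying ∑_{j=0}^{d_i} e^i_j(p)² = d_i + 1 for every p ∈ M; set c_i = √(d_i + 1) and, for x in the unit sphere S^{d_i} of ℝ^{d_i+1}, u^i_x = ∑_{j=0}^{d_i} x_j e^i_j. Then for any t_1, …, t_l ∈ [−1, 1], the integral over (x^1, …, x^l) ∈ S^{d_1} × ⋯ × S^{d_l} (with respect to the product of the rotation-invariant probability measures σ_i on the spheres) of μ({p ∈ M : u^i_{x^i}(p) ≥ c_i t_i for all i = 1,…,l}) equals ∏_{i=1}^l (ϖ_{d_i−1}/ϖ_{d_i}) ∫_{t_i}^{1} (1 − τ²)^{d_i/2 − 1} dτ, where ϖ_k = 2π^{(k+1)/2}/Γ((k+1)/2) is the surface area of the unit sphere S^k. -/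
open MeasureTheory Real Filter

/-- `varpi k` is the surface area `ϖ_k = 2π^((k+1)/2)/Γ((k+1)/2)` of the unit sphere `S^k`. -/
noncomputable def varpi (k : ℝ) : ℝ :=
  2 * Real.pi ^ ((k + 1) / 2) / Real.Gamma ((k + 1) / 2)

/-- For a rotation-invariant measure, the measure of a half-space or cone depends only on the norm
of its normal vector. -/
lemma measure_cap_eq {E : Type*} [NormedAddCommGroup E] [InnerProductSpace ℝ E]
    [MeasurableSpace E] [BorelSpace E] {ρ : Measure E}
    (hρ : ∀ g : E ≃ₗᵢ[ℝ] E, ρ.map g = ρ) (φ : ℝ → ℝ) (hφ : Continuous φ)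
    {v w : E} (hvw : ‖v‖ = ‖w‖) :
    ρ {x | φ ‖x‖ ≤ inner ℝ x v} = ρ {x | φ ‖x‖ ≤ inner ℝ x w} := by
  set g : E ≃ₗᵢ[ℝ] E := Submodule.reflection (ℝ ∙ (v - w))ᗮ
  have hg : g v = w := Submodule.reflection_sub hvw
  have hms : MeasurableSet {x : E | φ ‖x‖ ≤ inner ℝ x w} :=
    (isClosed_le (by fun_prop) (by fun_prop)).measurableSet
  conv_rhs => rw [← hρ g, Measure.map_apply g.continuous.measurable hms]
  congr 1
  ext x
  simp only [Set.mem_ofPred_eq, Set.mem_preimage, ← hg, LinearIsometryEquiv.norm_map,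
    LinearIsometryEquiv.inner_map_map]

/-- The spherical cap measure of a rotation-invariant probability measure on the sphere is the
proportion of any other rotation-invariant finite measure carried by the corresponding cone. -/
lemma measure_univ_mul_measure_cap {E : Type*} [NormedAddCommGroup E] [InnerProductSpace ℝ E]
    [MeasurableSpace E] [BorelSpace E] [SecondCountableTopology E]
    {σ ν : Measure E} [IsProbabilityMeasure σ] [IsFiniteMeasure ν]
    (hσsph : σ (Metric.sphere 0 1) = 1)
    (hσ : ∀ g : E ≃ₗᵢ[ℝ] E, σ.map g = σ) (hν : ∀ g : E ≃ₗᵢ[ℝ] E, ν.map g = ν)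
    (hν0 : ν {0} = 0) (t : ℝ) {u : E} (hu : ‖u‖ = 1) :
    ν Set.univ * σ {x | t ≤ inner ℝ x u} = ν {v | t * ‖v‖ ≤ inner ℝ v u} := by
  have hS : MeasurableSet {q : E × E | t * ‖q.2‖ ≤ inner ℝ q.1 q.2} :=
    (isClosed_le (by fun_prop) (by fun_prop)).measurableSet
  have h1 : ∀ᵐ v ∂ν, σ ((fun x => (x, v)) ⁻¹' {q : E × E | t * ‖q.2‖ ≤ inner ℝ q.1 q.2})
      = σ {x | t ≤ inner ℝ x u} := by
    have : ∀ᵐ v ∂ν, v ≠ 0 := by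
      rw [ae_iff]; simpa using hν0
    filter_upwards [this] with v hv
    have hv' : 0 < ‖v‖ := norm_pos_iff.mpr hv
    have := measure_cap_eq hσ (fun _ => t * ‖v‖) continuous_const (v := v) (w := ‖v‖ • u)
      (by simp [norm_smul, hu])
    simp only [inner_smul_right] at this
    refine this.trans ?_
    congr 1
    ext x
    simp only [Set.mem_ofPred_eq]
    rw [mul_comm t, mul_le_mul_iff_right₀ hv']
  have h2 : ∀ᵐ x ∂σ, ν (Prod.mk x ⁻¹' {q : E × E | t * ‖q.2‖ ≤ inner ℝ q.1 q.2})
      = ν {v | t * ‖v‖ ≤ inner ℝ v u} := by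
    have : ∀ᵐ x ∂σ, x ∈ Metric.sphere (0 : E) 1 :=
      (mem_ae_iff_prob_eq_one Metric.isClosed_sphere.measurableSet).2 hσsph
    filter_upwards [this] with x hx
    have hx' : ‖x‖ = ‖u‖ := by rw [hu]; simpa using hx
    rw [← measure_cap_eq hν (fun r => t * r) (by fun_prop) hx']
    congr 1
    ext v
    simp [real_inner_comm]
  have := Measure.prod_apply (μ := σ) (ν := ν) hS
  rw [Measure.prod_apply_symm hS, lintegral_congr_ae h1, lintegral_congr_ae h2] at this
  simpa [mul_comm] using this

lemma integral_sin_pow_indicator_cos (n : ℕ) {t : ℝ} (ht : t ∈ Set.Icc (-1 : ℝ) 1) :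
    ∫ θ in Set.Ioo 0 π ∩ {θ | t ≤ cos θ}, sin θ ^ n
      = ∫ τ in t..1, (1 - τ ^ 2) ^ (((n + 1 : ℕ) : ℝ) / 2 - 1) := by
  set A : Set ℝ := Set.Ioo 0 π ∩ {θ | t ≤ cos θ}
  have hA : MeasurableSet A :=
    measurableSet_Ioo.inter (isClosed_le continuous_const continuous_cos).measurableSet
  have himg : cos '' A = Set.Ioo (-1) 1 ∩ Set.Ici t := by
    ext y
    constructor
    · rintro ⟨θ, ⟨⟨h0, hπ⟩, h⟩, rfl⟩
      refine ⟨⟨?_, ?_⟩, h⟩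
      · rw [← cos_pi]
        exact strictAntiOn_cos ⟨h0.le, hπ.le⟩ ⟨pi_pos.le, le_rfl⟩ hπ
      · rw [← cos_zero]
        exact strictAntiOn_cos ⟨le_rfl, pi_pos.le⟩ ⟨h0.le, hπ.le⟩ h0
    · rintro ⟨⟨h1, h2⟩, h3⟩
      refine ⟨arccos y, ⟨⟨arccos_pos.2 h2, ?_⟩, ?_⟩, cos_arccos h1.le h2.le⟩
      · exact lt_of_le_of_ne (arccos_le_pi y) (fun h => by rw [arccos_eq_pi] at h; linarith)
      · simpa [cos_arccos h1.le h2.le] using h3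
  have hinj : Set.InjOn cos A :=
    injOn_cos.mono fun θ hθ => Set.mem_Icc.2 ⟨hθ.1.1.le, hθ.1.2.le⟩
  rw [intervalIntegral.integral_of_le ht.2]
  have hae : (Set.Ioc t 1 : Set ℝ) =ᵐ[volume] (Set.Ioo (-1) 1 ∩ Set.Ici t : Set ℝ) := by
    have h1 : ∀ᵐ τ : ℝ, τ ≠ 1 := by simp [ae_iff]
    have h2 : ∀ᵐ τ : ℝ, τ ≠ t := by simp [ae_iff]
    filter_upwards [h1, h2] with τ h1 h2
    apply propext
    change τ ∈ Set.Ioc t 1 ↔ τ ∈ Set.Ioo (-1) 1 ∩ Set.Ici t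
    simp only [Set.mem_Ioc, Set.mem_inter_iff, Set.mem_Ioo, Set.mem_Ici]
    constructor
    · rintro ⟨h3, h4⟩
      exact ⟨⟨ht.1.trans_lt h3, lt_of_le_of_ne h4 h1⟩, h3.le⟩
    · rintro ⟨⟨h3, h4⟩, h5⟩
      exact ⟨lt_of_le_of_ne h5 h2.symm, h4.le⟩
  rw [setIntegral_congr_set hae, ← himg,
    integral_image_eq_integral_abs_deriv_smul hA
      (fun θ _ => (hasDerivAt_cos θ).hasDerivWithinAt) hinj]
  refine setIntegral_congr_fun hA fun θ hθ => ?_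
  have hs : 0 < sin θ := sin_pos_of_pos_of_lt_pi hθ.1.1 hθ.1.2
  simp only [abs_neg, abs_of_pos hs, smul_eq_mul]
  rw [← sin_sq, ← rpow_natCast _ 2, ← rpow_mul hs.le, ← rpow_natCast _ n]
  nth_rewrite 2 [← rpow_one (sin θ)]
  rw [← rpow_add hs]
  congr 1
  push_cast; ring

lemma integral_polar_cap (n : ℕ) {t : ℝ} (ht : t ∈ Set.Icc (-1 : ℝ) 1) :
    ∫ q : ℝ × ℝ, (if 0 < q.2 ∧ t * √(q.1 ^ 2 + q.2 ^ 2) ≤ q.1 then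
        q.2 ^ n * rexp (-(q.1 ^ 2 + q.2 ^ 2)) else 0)
      = Gamma ((n + 2 : ℝ) / 2) / 2 * ∫ τ in t..1, (1 - τ ^ 2) ^ (((n + 1 : ℕ) : ℝ) / 2 - 1) := by
  rw [← integral_comp_polarCoord_symm, polarCoord_target, Measure.volume_eq_prod]
  have hA : MeasurableSet {θ : ℝ | 0 < sin θ ∧ t ≤ cos θ} :=
    (measurableSet_lt measurable_const measurable_sin).inter
      (measurableSet_le measurable_const measurable_cos)
  have h1 : ∀ q ∈ Set.Ioi (0 : ℝ) ×ˢ Set.Ioo (-π) π,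
      q.1 • (if 0 < (polarCoord.symm q).2 ∧
          t * √((polarCoord.symm q).1 ^ 2 + (polarCoord.symm q).2 ^ 2) ≤ (polarCoord.symm q).1 then
        (polarCoord.symm q).2 ^ n *
          rexp (-((polarCoord.symm q).1 ^ 2 + (polarCoord.symm q).2 ^ 2)) else 0)
      = (q.1 ^ (n + 1 : ℝ) * rexp (-q.1 ^ (2 : ℝ))) *
        ({θ : ℝ | 0 < sin θ ∧ t ≤ cos θ}.indicator (fun θ => sin θ ^ n) q.2) := by
    rintro ⟨r, θ⟩ ⟨hr, -⟩
    replace hr : 0 < r := hr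
    have e1 : (r * cos θ) ^ 2 + (r * sin θ) ^ 2 = r ^ 2 := by
      linear_combination r ^ 2 * sin_sq_add_cos_sq θ
    have e2 : r ^ (n + 1 : ℝ) = r ^ (n + 1) := by exact_mod_cast rpow_natCast r (n + 1)
    simp only [polarCoord_symm_apply, e1, sqrt_sq hr.le, Set.indicator, Set.mem_ofPred_eq,
      mul_comm t r, mul_le_mul_iff_right₀ hr, mul_pos_iff_of_pos_left hr, smul_eq_mul, e2,
      rpow_two]
    split_ifs
    · ring
    · simp
  rw [setIntegral_congr_fun (measurableSet_Ioi.prod measurableSet_Ioo) h1,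
    setIntegral_prod_mul (fun r : ℝ => r ^ (n + 1 : ℝ) * rexp (-r ^ (2 : ℝ)))
      ({θ : ℝ | 0 < sin θ ∧ t ≤ cos θ}.indicator (fun θ => sin θ ^ n)),
    integral_rpow_mul_exp_neg_rpow two_pos (by linarith [n.cast_nonneg (α := ℝ)]),
    setIntegral_indicator hA, ← integral_sin_pow_indicator_cos n ht]
  congr 1
  · ring_nf
  · congr 2
    ext θ
    simp only [Set.mem_inter_iff, Set.mem_Ioo, Set.mem_ofPred_eq]
    constructor
    · rintro ⟨⟨h1, h2⟩, h3, h4⟩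
      refine ⟨⟨?_, h2⟩, h4⟩
      by_contra! h
      linarith [sin_nonpos_of_nonpos_of_neg_pi_le h h1.le]
    · rintro ⟨⟨h1, h2⟩, h4⟩
      exact ⟨⟨by linarith [pi_pos], h2⟩, sin_pos_of_pos_of_lt_pi h1 h2, h4⟩

lemma integrable_rexp_neg_norm_sq (V : Type*) [NormedAddCommGroup V] [InnerProductSpace ℝ V]
    [FiniteDimensional ℝ V] [MeasurableSpace V] [BorelSpace V] :
    Integrable (fun v : V => rexp (-‖v‖ ^ 2)) := by
  refine Integrable.of_integral_ne_zero ?_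
  have h := GaussianFourier.integral_rexp_neg_mul_sq_norm (V := V) one_pos
  simp only [neg_mul, one_mul, div_one] at h
  rw [h]
  positivity

lemma integral_euclideanSpace_succ (n : ℕ) (f : ℝ → ℝ → ℝ) :
    ∫ v : EuclideanSpace ℝ (Fin (n + 1)), f (v 0) (‖v‖ ^ 2)
      = ∫ q : ℝ × EuclideanSpace ℝ (Fin n), f q.1 (q.1 ^ 2 + ‖q.2‖ ^ 2) := by
  rw [← (EuclideanSpace.volume_preserving_symm_measurableEquiv_toLp
      (Fin (n + 1))).symm.integral_comp',
    ← ((volume_preserving_piFinSuccAbove (fun _ : Fin (n + 1) => ℝ) 0).symm).integral_comp']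
  have hprod := (MeasurePreserving.id (volume : Measure ℝ)).prod
    (EuclideanSpace.volume_preserving_symm_measurableEquiv_toLp (Fin n)).symm
  refine Eq.trans ?_ (hprod.integral_comp ((MeasurableEquiv.refl ℝ).prodCongr
    (MeasurableEquiv.toLp 2 (Fin n → ℝ))).measurableEmbedding _)
  refine integral_congr_ae (.of_forall fun q => ?_)
  simp [EuclideanSpace.norm_sq_eq, Fin.sum_univ_succ]

lemma finrank_mul_volume_ball (n : ℕ) :
    (n + 1 : ℝ) * volume.real (Metric.ball (0 : EuclideanSpace ℝ (Fin (n + 1))) 1)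
      = 2 * π ^ ((n + 1 : ℝ) / 2) / Gamma ((n + 1 : ℝ) / 2) := by
  have hG : Gamma ((n + 1 : ℝ) / 2 + 1) = (n + 1 : ℝ) / 2 * Gamma ((n + 1 : ℝ) / 2) :=
    Gamma_add_one (by positivity)
  have hpos : 0 < Gamma ((n + 1 : ℝ) / 2) := Gamma_pos_of_pos (by positivity)
  have hpi : √π ^ (n + 1) = π ^ ((n + 1 : ℝ) / 2) := by
    rw [sqrt_eq_rpow, ← rpow_mul_natCast pi_pos.le]
    congr 1
    push_cast
    ring
  rw [Measure.real, EuclideanSpace.volume_ball]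
  simp only [Fintype.card_fin, ENNReal.ofReal_one, one_pow, one_mul, Nat.cast_add, Nat.cast_one]
  rw [ENNReal.toReal_ofReal (by rw [hG]; positivity), hG, hpi]
  field_simp

/-- The Gaussian integral over a circular cone, computed in cylindrical and then polar coordinates. -/
lemma integral_cone_gaussian (n : ℕ) {t : ℝ} (ht : t ∈ Set.Icc (-1 : ℝ) 1) :
    ∫ v : EuclideanSpace ℝ (Fin (n + 2)), (if t * ‖v‖ ≤ v 0 then rexp (-‖v‖ ^ 2) else 0)
      = 2 * π ^ ((n + 1 : ℝ) / 2) / Gamma ((n + 1 : ℝ) / 2) *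
        (Gamma ((n + 2 : ℝ) / 2) / 2 *
          ∫ τ in t..1, (1 - τ ^ 2) ^ (((n + 1 : ℕ) : ℝ) / 2 - 1)) := by
  let f : ℝ → ℝ → ℝ := fun a s => if t * √s ≤ a then rexp (-s) else 0
  have hf : Measurable (fun q : ℝ × ℝ => f q.1 q.2) :=
    Measurable.ite (measurableSet_le (by fun_prop) (by fun_prop)) (by fun_prop) (by fun_prop)
  have hfb : ∀ a s, ‖f a s‖ ≤ rexp (-s) := fun a s => by
    simp only [f]
    split_ifs
    · simp
    · simpa using (exp_pos _).le
  have hint1 : Integrable (fun a : ℝ => rexp (-a ^ 2)) := by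
    simpa using integrable_rexp_neg_norm_sq ℝ
  have hL : (fun v : EuclideanSpace ℝ (Fin (n + 2)) =>
      if t * ‖v‖ ≤ v 0 then rexp (-‖v‖ ^ 2) else 0) = fun v => f (v 0) (‖v‖ ^ 2) := by
    ext v
    simp only [f, sqrt_sq (norm_nonneg v)]
  rw [hL, integral_euclideanSpace_succ, Measure.volume_eq_prod, integral_prod]
  · have h1 : ∀ a : ℝ, ∫ w : EuclideanSpace ℝ (Fin (n + 1)), f a (a ^ 2 + ‖w‖ ^ 2)
        = 2 * π ^ ((n + 1 : ℝ) / 2) / Gamma ((n + 1 : ℝ) / 2) *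
          ∫ r, (Set.Ioi (0 : ℝ)).indicator (fun r => r ^ n * f a (a ^ 2 + r ^ 2)) r := by
      intro a
      rw [integral_fun_norm_addHaar volume (fun r => f a (a ^ 2 + r ^ 2)),
        ← finrank_mul_volume_ball, integral_indicator measurableSet_Ioi]
      simp [mul_assoc]
    simp only [h1]
    rw [integral_const_mul, ← integral_polar_cap n ht]
    congr 1
    rw [Measure.volume_eq_prod, integral_prod]
    · refine integral_congr_ae (.of_forall fun a => integral_congr_ae (.of_forall fun r => ?_))
      simp only [f, Set.indicator, Set.mem_Ioi]
      split_ifs <;> simp_all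
    · have hint2 : Integrable
          ((Set.Ioi (0 : ℝ)).indicator fun r : ℝ => r ^ n * rexp (-r ^ 2)) := by
        rw [integrable_indicator_iff measurableSet_Ioi]
        simpa using (integrable_fun_norm_addHaar
          (volume : Measure (EuclideanSpace ℝ (Fin (n + 1))))
          (f := fun r => rexp (-r ^ 2))).1 (integrable_rexp_neg_norm_sq _)
      refine (hint1.mul_prod hint2).mono' (Measurable.aestronglyMeasurable ?_)
        (.of_forall fun q => ?_)
      · refine Measurable.ite (MeasurableSet.inter (s₁ := {q : ℝ × ℝ | 0 < q.2})
          (s₂ := {q : ℝ × ℝ | t * √(q.1 ^ 2 + q.2 ^ 2) ≤ q.1})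
          (measurableSet_lt (by fun_prop) (by fun_prop))
          (measurableSet_le (by fun_prop) (by fun_prop))) (by fun_prop) (by fun_prop)
      · by_cases hq : 0 < q.2
        · simp only [hq, true_and, Set.indicator, Set.mem_Ioi, if_true]
          split_ifs
          · rw [norm_of_nonneg (by positivity), neg_add, exp_add]
            exact le_of_eq (by ring)
          · simp; positivity
        · simp [hq]
  · refine (hint1.mul_prod (integrable_rexp_neg_norm_sq _)).mono'
      (Measurable.aestronglyMeasurable ?_) (.of_forall fun q => ?_)
    · exact hf.comp (f := fun q : ℝ × EuclideanSpace ℝ (Fin (n + 1)) =>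
        (q.1, q.1 ^ 2 + ‖q.2‖ ^ 2)) (by fun_prop)
    · rw [← exp_add, ← neg_add]
      exact hfb _ _

/-- The measure of a spherical cap for the rotation-invariant probability measure on `S^d`. -/
lemma measureReal_sphere_cap {d : ℕ} (hd : 1 ≤ d)
    {σ : Measure (EuclideanSpace ℝ (Fin (d + 1)))} [IsProbabilityMeasure σ]
    (hσsph : σ (Metric.sphere 0 1) = 1)
    (hσ : ∀ g : EuclideanSpace ℝ (Fin (d + 1)) ≃ₗᵢ[ℝ] EuclideanSpace ℝ (Fin (d + 1)),
      σ.map g = σ)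
    {t : ℝ} (ht : t ∈ Set.Icc (-1 : ℝ) 1) {u : EuclideanSpace ℝ (Fin (d + 1))} (hu : ‖u‖ = 1) :
    σ.real {x | t ≤ inner ℝ x u}
      = varpi ((d : ℝ) - 1) / varpi d * ∫ τ in t..1, (1 - τ ^ 2) ^ ((d : ℝ) / 2 - 1) := by
  obtain ⟨n, rfl⟩ : ∃ n, d = n + 1 := ⟨d - 1, by omega⟩
  have hint := integrable_rexp_neg_norm_sq (EuclideanSpace ℝ (Fin (n + 1 + 1)))
  set ν : Measure (EuclideanSpace ℝ (Fin (n + 1 + 1))) := volume.withDensity fun v => ENNReal.ofReal (rexp (-‖v‖ ^ 2)) with hνdef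
  have : IsFiniteMeasure ν := isFiniteMeasure_withDensity_ofReal hint.2
  have hνS : ∀ S : Set (EuclideanSpace ℝ (Fin (n + 1 + 1))), MeasurableSet S → ν.real S = ∫ v in S, rexp (-‖v‖ ^ 2) := fun S hS => by
    rw [Measure.real, hνdef, withDensity_apply _ hS,
      ← ofReal_integral_eq_lintegral_ofReal hint.restrict (.of_forall fun _ => (exp_pos _).le),
      ENNReal.toReal_ofReal (integral_nonneg fun _ => (exp_pos _).le)]
  have hν : ∀ g : EuclideanSpace ℝ (Fin (n + 1 + 1)) ≃ₗᵢ[ℝ]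
      EuclideanSpace ℝ (Fin (n + 1 + 1)), ν.map g = ν := fun g => by
    ext S hS
    have hgS : MeasurableSet (g ⁻¹' S) := g.continuous.measurable hS
    rw [Measure.map_apply g.continuous.measurable hS, hνdef, withDensity_apply _ hS,
      withDensity_apply _ hgS,
      ← g.measurePreserving.setLIntegral_comp_preimage hS (by fun_prop)]
    simp
  have hν0 : ν {0} = 0 := withDensity_absolutelyContinuous _ _ (by simp)
  have hcap := measure_cap_eq hσ (fun _ => t) continuous_const (v := u)
    (w := EuclideanSpace.single 0 1) (by simp [hu])
  have key := measure_univ_mul_measure_cap hσsph hσ hν hν0 t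
    (u := EuclideanSpace.single 0 1) (by simp)
  rw [← hcap] at key
  replace key := congrArg ENNReal.toReal key
  rw [ENNReal.toReal_mul] at key
  change ν.real _ * σ.real _ = ν.real _ at key
  have hS : MeasurableSet {v : EuclideanSpace ℝ (Fin (n + 1 + 1)) | t * ‖v‖ ≤ v 0} :=
    measurableSet_le (by fun_prop) (by fun_prop)
  have hset : {v : EuclideanSpace ℝ (Fin (n + 1 + 1)) | t * ‖v‖ ≤ inner ℝ v (EuclideanSpace.single 0 1)}
      = {v : EuclideanSpace ℝ (Fin (n + 1 + 1)) | t * ‖v‖ ≤ v 0} := by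
    ext v; simp [EuclideanSpace.inner_single_right]
  have htot : ν.real Set.univ = π ^ ((n + 2 : ℝ) / 2) := by
    have h := GaussianFourier.integral_rexp_neg_mul_sq_norm (V := EuclideanSpace ℝ (Fin (n + 1 + 1))) one_pos
    simp only [neg_mul, one_mul, div_one] at h
    rw [hνS _ MeasurableSet.univ, setIntegral_univ, h]
    simp only [finrank_euclideanSpace, Fintype.card_fin]
    congr 2
    push_cast
    ring
  have hcone : ∫ v in {v : EuclideanSpace ℝ (Fin (n + 1 + 1)) | t * ‖v‖ ≤ v 0}, rexp (-‖v‖ ^ 2)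
      = ∫ v : EuclideanSpace ℝ (Fin (n + 1 + 1)), (if t * ‖v‖ ≤ v 0 then rexp (-‖v‖ ^ 2) else 0) := by
    rw [← integral_indicator hS]
    rfl
  rw [hset, hνS _ hS, htot, hcone, integral_cone_gaussian n ht] at key
  have hpi : 0 < π ^ ((n + 2 : ℝ) / 2) := by positivity
  have hG1 : 0 < Gamma ((n + 1 : ℝ) / 2) := Gamma_pos_of_pos (by positivity)
  have hG2 : 0 < Gamma ((n + 2 : ℝ) / 2) := Gamma_pos_of_pos (by positivity)
  have e1 : ((n + 1 : ℕ) : ℝ) - 1 + 1 = n + 1 := by push_cast; ring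
  have e2 : ((n + 1 : ℕ) : ℝ) + 1 = n + 2 := by push_cast; ring
  rw [varpi, varpi, e1, e2]
  refine mul_left_cancel₀ hpi.ne' (key.trans ?_)
  field_simp

theorem stmt_0
    {M : Type*} [MeasurableSpace M] (μ : Measure M) [IsProbabilityMeasure μ]
    (l : ℕ) (hl : 1 ≤ l)
    (d : Fin l → ℕ) (hd : ∀ i, 1 ≤ d i)
    (e : (i : Fin l) → Fin (d i + 1) → M → ℝ)
    (hmeas : ∀ i j, Measurable (e i j))
    (horth : ∀ i, ∀ j k : Fin (d i + 1),
      ∫ p, e i j p * e i k p ∂μ = if j = k then 1 else 0)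
    (hdiag : ∀ i, ∀ p : M, ∑ j, (e i j p) ^ 2 = (d i : ℝ) + 1)
    (σ : (i : Fin l) → Measure (EuclideanSpace ℝ (Fin (d i + 1))))
    [∀ i, IsProbabilityMeasure (σ i)]
    (hσsph : ∀ i, σ i (Metric.sphere (0 : EuclideanSpace ℝ (Fin (d i + 1))) 1) = 1)
    (hσinv : ∀ i, ∀ g : EuclideanSpace ℝ (Fin (d i + 1)) ≃ₗᵢ[ℝ] EuclideanSpace ℝ (Fin (d i + 1)),
      (σ i).map g = σ i)
    (t : Fin l → ℝ) (ht : ∀ i, t i ∈ Set.Icc (-1 : ℝ) 1) :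
    ∫ x : (i : Fin l) → EuclideanSpace ℝ (Fin (d i + 1)),
        (μ {p : M | ∀ i, Real.sqrt ((d i : ℝ) + 1) * t i ≤ ∑ j, x i j * e i j p}).toReal
        ∂(Measure.pi σ)
      = ∏ i, varpi ((d i : ℝ) - 1) / varpi (d i) *
          ∫ τ in (t i)..1, (1 - τ ^ 2) ^ ((d i : ℝ) / 2 - 1) := by
  let S : Set (((i : Fin l) → EuclideanSpace ℝ (Fin (d i + 1))) × M) :=
    {q | ∀ i, √((d i : ℝ) + 1) * t i ≤ ∑ j, q.1 i j * e i j q.2}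
  have hS : MeasurableSet S := by
    simp only [S, Set.ofPred_forall]
    refine MeasurableSet.iInter fun i => measurableSet_le measurable_const ?_
    refine Finset.measurable_sum _ fun j _ => Measurable.mul ?_ ((hmeas i j).comp measurable_snd)
    have : Measurable fun q : ((i : Fin l) → EuclideanSpace ℝ (Fin (d i + 1))) × M => q.1 i := (measurable_pi_apply i).comp measurable_fst
    fun_prop
  have hsec : ∀ p, Measure.pi σ ((fun x => (x, p)) ⁻¹' S) = ENNReal.ofReal
      (∏ i, varpi ((d i : ℝ) - 1) / varpi (d i) *
        ∫ τ in (t i)..1, (1 - τ ^ 2) ^ ((d i : ℝ) / 2 - 1)) := by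
    intro p
    let u : (i : Fin l) → EuclideanSpace ℝ (Fin (d i + 1)) := fun i =>
      (√((d i : ℝ) + 1))⁻¹ • WithLp.toLp 2 fun j => e i j p
    have hc : ∀ i, 0 < √((d i : ℝ) + 1) := fun i => sqrt_pos.2 (by positivity)
    have hu : ∀ i, ‖u i‖ = 1 := fun i => by
      have : ‖(WithLp.toLp 2 fun j => e i j p : EuclideanSpace ℝ (Fin (d i + 1)))‖
          = √((d i : ℝ) + 1) := by
        rw [EuclideanSpace.norm_eq, ← hdiag i p]
        simp
      rw [norm_smul, this, norm_inv, norm_of_nonneg (hc i).le, inv_mul_cancel₀ (hc i).ne']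
    have hpre : (fun x => (x, p)) ⁻¹' S
        = Set.univ.pi fun i => {x | t i ≤ inner ℝ x (u i)} := by
      ext x
      rw [Set.mem_univ_pi]
      refine forall_congr' fun i => ?_
      simp only [u, Set.mem_ofPred_eq, inner_smul_right]
      rw [inv_mul_eq_div, le_div_iff₀ (hc i), mul_comm (t i)]
      simp [PiLp.inner_apply, mul_comm]
    rw [hpre, Measure.pi_pi, ← ENNReal.ofReal_toReal
      (ENNReal.prod_ne_top fun i _ => measure_ne_top (σ i) _), ENNReal.toReal_prod]
    congr 1
    exact Finset.prod_congr rfl fun i _ =>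
      measureReal_sphere_cap (hd i) (hσsph i) (hσinv i) (ht i) (hu i)
  have hnonneg : 0 ≤ ∏ i, varpi ((d i : ℝ) - 1) / varpi (d i) *
      ∫ τ in (t i)..1, (1 - τ ^ 2) ^ ((d i : ℝ) / 2 - 1) := by
    refine Finset.prod_nonneg fun i _ => ?_
    rw [← measureReal_sphere_cap (hd i) (hσsph i) (hσinv i) (ht i)
      (u := EuclideanSpace.single 0 1) (by simp)]
    exact measureReal_nonneg
  have hprod := Measure.prod_apply (μ := Measure.pi σ) (ν := μ) hS
  rw [Measure.prod_apply_symm hS] at hprod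
  simp only [hsec, lintegral_const, measure_univ, mul_one] at hprod
  change ∫ x, (μ (Prod.mk x ⁻¹' S)).toReal ∂(Measure.pi σ) = _
  rw [integral_toReal (measurable_measure_prodMk_left hS).aemeasurable
    (.of_forall fun _ => measure_lt_top _ _), ← hprod, ENNReal.toReal_ofReal hnonneg]
end

section
/- Let (M, μ) be a probability space, d ≥ 1, and e_0, …, e_d : M → ℝ measurable functions forming an orthonormal family in L²(μ) and satisfying ∑_{i=0}^d e_i(p)² = d + 1 for every p ∈ M. Let S^d be the unit sphere of ℝ^{d+1} with its rotation-invariant probability measure σ, and for x ∈ S^d set u_x = ∑_{i=0}^d x_i e_i and c = √(d+1). Then for every bounded Borel measurable function f : ℝ → ℝ, ∫_{S^d} (∫_M f(u_x(p)) dμ(p)) dσ(x) = (ϖ_{d−1}/(c ϖ_d)) ∫_{−c}^{c} f(t) (1 − t²/c²)^{d/2 − 1} dt, where ϖ_k = 2π^{(k+1)/2}/Γ((k+1)/2). -/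
open MeasureTheory Real Filter

open scoped ENNReal RealInnerProductSpace

theorem lintegral_fun_norm_addHaar {E : Type*} [NormedAddCommGroup E] [NormedSpace ℝ E]
    [MeasurableSpace E] [BorelSpace E] [FiniteDimensional ℝ E] [Nontrivial E]
    (ν : Measure E) [ν.IsAddHaarMeasure] {f : ℝ → ℝ≥0∞} (hf : Measurable f) :
    ∫⁻ x, f ‖x‖ ∂ν = Module.finrank ℝ E * ν (Metric.ball 0 1) *
      ∫⁻ r in Set.Ioi (0 : ℝ), ENNReal.ofReal (r ^ (Module.finrank ℝ E - 1)) * f r := by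
  calc ∫⁻ x, f ‖x‖ ∂ν = ∫⁻ x : ({0}ᶜ : Set E), f ‖x.1‖ ∂(ν.comap (↑)) := by
        rw [lintegral_subtype_comap (measurableSet_singleton _).compl fun x ↦ f ‖x‖,
          restrict_compl_singleton]
    _ = ∫⁻ x, f x.2 ∂ν.toSphere.prod (.volumeIoiPow (Module.finrank ℝ E - 1)) := by
        rw [← ν.measurePreserving_homeomorphUnitSphereProd.lintegral_comp_emb
          (Homeomorph.measurableEmbedding _)]
        simp
    _ = ν.toSphere Set.univ *
          ∫⁻ x : Set.Ioi (0 : ℝ), f x ∂.volumeIoiPow (Module.finrank ℝ E - 1) := by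
        rw [lintegral_prod _ (by fun_prop)]
        simp [mul_comm]
    _ = _ := by
        rw [Measure.volumeIoiPow, lintegral_withDensity_eq_lintegral_mul _ (by fun_prop)
          (by fun_prop), Measure.toSphere_apply_univ,
          ← lintegral_subtype_comap measurableSet_Ioi]
        rfl

theorem EuclideanSpace.lintegral_succ {d : ℕ} {H : ℝ → ℝ → ℝ≥0∞}
    (hH : Measurable (Function.uncurry H)) :
    ∫⁻ y : EuclideanSpace ℝ (Fin (d + 1)), H (y 0) ‖y‖ =
      ∫⁻ z : EuclideanSpace ℝ (Fin d), ∫⁻ s : ℝ, H s √(s ^ 2 + ‖z‖ ^ 2) := by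
  have hmeas : Measurable fun q : ℝ × (Fin d → ℝ) ↦ H q.1 √(q.1 ^ 2 + ∑ i, q.2 i ^ 2) :=
    hH.comp (f := fun q : ℝ × (Fin d → ℝ) ↦ (q.1, √(q.1 ^ 2 + ∑ i, q.2 i ^ 2))) (by fun_prop)
  calc ∫⁻ y : EuclideanSpace ℝ (Fin (d + 1)), H (y 0) ‖y‖
      = ∫⁻ y : Fin (d + 1) → ℝ, H (y 0) √(y 0 ^ 2 + ∑ i : Fin d, y i.succ ^ 2) := by
        rw [← (PiLp.volume_preserving_toLp (Fin (d + 1))).lintegral_comp_emb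
          (MeasurableEquiv.toLp 2 _).measurableEmbedding]
        simp [EuclideanSpace.norm_eq, Fin.sum_univ_succ]
    _ = ∫⁻ q : ℝ × (Fin d → ℝ), H q.1 √(q.1 ^ 2 + ∑ i, q.2 i ^ 2) := by
        rw [← (volume_preserving_piFinSuccAbove (fun _ : Fin (d + 1) ↦ ℝ) 0).lintegral_comp_emb
          (MeasurableEquiv.measurableEmbedding _)]
        simp [MeasurableEquiv.piFinSuccAbove, Fin.tail]
    _ = ∫⁻ z : Fin d → ℝ, ∫⁻ s : ℝ, H s √(s ^ 2 + ∑ i, z i ^ 2) := by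
        rw [Measure.volume_eq_prod, lintegral_prod_symm _ hmeas.aemeasurable]
    _ = _ := by
        rw [← (PiLp.volume_preserving_toLp (Fin d)).lintegral_comp_emb
          (MeasurableEquiv.toLp 2 _).measurableEmbedding]
        simp [EuclideanSpace.norm_eq, Real.sq_sqrt, Finset.sum_nonneg, sq_nonneg]

theorem div_sqrt_one_sub_sq_sq_add_sq {r w : ℝ} (hw : w ∈ Set.Ioo (-1 : ℝ) 1) :
    (r * (w / √(1 - w ^ 2))) ^ 2 + r ^ 2 = r ^ 2 / (1 - w ^ 2) := by
  have h : 0 < 1 - w ^ 2 := by nlinarith [hw.1, hw.2]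
  rw [mul_pow, div_pow, Real.sq_sqrt h.le]
  field_simp
  ring

theorem sqrt_div_sqrt_one_sub_sq_sq_add_sq {r w : ℝ} (hr : 0 < r)
    (hw : w ∈ Set.Ioo (-1 : ℝ) 1) :
    √((r * (w / √(1 - w ^ 2))) ^ 2 + r ^ 2) = r / √(1 - w ^ 2) := by
  rw [div_sqrt_one_sub_sq_sq_add_sq hw, Real.sqrt_div (sq_nonneg r), Real.sqrt_sq hr.le]

theorem div_sqrt_one_sub_sq_div_norm {r w : ℝ} (hr : 0 < r) (hw : w ∈ Set.Ioo (-1 : ℝ) 1) :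
    r * (w / √(1 - w ^ 2)) / √((r * (w / √(1 - w ^ 2))) ^ 2 + r ^ 2) = w := by
  have h : 0 < √(1 - w ^ 2) := Real.sqrt_pos.2 (by nlinarith [hw.1, hw.2])
  rw [sqrt_div_sqrt_one_sub_sq_sq_add_sq hr hw]
  field_simp

theorem image_mul_div_sqrt_one_sub_sq {r : ℝ} (hr : 0 < r) :
    (fun w : ℝ ↦ r * (w / √(1 - w ^ 2))) '' Set.Ioo (-1) 1 = Set.univ := by
  refine Set.eq_univ_of_forall fun s ↦ ?_
  have hpos : 0 < s ^ 2 + r ^ 2 := by positivity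
  have h : 1 - (s / √(s ^ 2 + r ^ 2)) ^ 2 = r ^ 2 / (s ^ 2 + r ^ 2) := by
    rw [div_pow, Real.sq_sqrt hpos.le]
    field_simp
    ring
  have hlt : (s / √(s ^ 2 + r ^ 2)) ^ 2 < 1 := by
    have : 0 < r ^ 2 / (s ^ 2 + r ^ 2) := by positivity
    linarith
  refine ⟨s / √(s ^ 2 + r ^ 2), by rwa [sq_lt_one_iff_abs_lt_one, abs_lt] at hlt, ?_⟩
  have : 0 < √(s ^ 2 + r ^ 2) := Real.sqrt_pos.2 hpos
  simp only [h]
  rw [Real.sqrt_div (sq_nonneg r), Real.sqrt_sq hr.le]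
  field_simp

theorem hasDerivAt_mul_div_sqrt_one_sub_sq {r w : ℝ} (hw : w ∈ Set.Ioo (-1 : ℝ) 1) :
    HasDerivAt (fun w : ℝ ↦ r * (w / √(1 - w ^ 2))) (r / √(1 - w ^ 2) ^ 3) w := by
  have h : 0 < 1 - w ^ 2 := by nlinarith [hw.1, hw.2]
  have hs : 0 < √(1 - w ^ 2) := Real.sqrt_pos.2 h
  have h1 : HasDerivAt (fun w : ℝ ↦ 1 - w ^ 2) (-(2 * w)) w := by
    simpa using (hasDerivAt_pow 2 w).const_sub 1
  refine (((hasDerivAt_id w).div (h1.sqrt h.ne') hs.ne').const_mul r).congr_deriv ?_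
  simp only [id]
  field_simp
  rw [Real.sq_sqrt h.le]
  ring

theorem lintegral_div_sqrt_sq_add_sq {r : ℝ} (hr : 0 < r) (H : ℝ → ℝ → ℝ≥0∞) :
    ∫⁻ s : ℝ, H (s / √(s ^ 2 + r ^ 2)) √(s ^ 2 + r ^ 2) =
      ∫⁻ w in Set.Ioo (-1 : ℝ) 1,
        ENNReal.ofReal (r / √(1 - w ^ 2) ^ 3) * H w (r / √(1 - w ^ 2)) := by
  have hinj : Set.InjOn (fun w : ℝ ↦ r * (w / √(1 - w ^ 2))) (Set.Ioo (-1) 1) := by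
    refine Set.LeftInvOn.injOn (f₁' := fun s ↦ s / √(s ^ 2 + r ^ 2)) fun w hw ↦ ?_
    exact div_sqrt_one_sub_sq_div_norm hr hw
  have := lintegral_image_eq_lintegral_abs_deriv_mul measurableSet_Ioo
    (fun w hw ↦ (hasDerivAt_mul_div_sqrt_one_sub_sq (r := r) hw).hasDerivWithinAt) hinj
    (fun s ↦ H (s / √(s ^ 2 + r ^ 2)) √(s ^ 2 + r ^ 2))
  rw [image_mul_div_sqrt_one_sub_sq hr, setLIntegral_univ] at this
  rw [this]
  refine setLIntegral_congr_fun measurableSet_Ioo fun w hw ↦ ?_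
  rw [div_sqrt_one_sub_sq_div_norm hr hw, sqrt_div_sqrt_one_sub_sq_sq_add_sq hr hw,
    abs_of_nonneg (by positivity)]

theorem setLIntegral_Ioo_pow {a : ℝ} (ha : 0 ≤ a) (n : ℕ) :
    ∫⁻ r in Set.Ioo 0 a, ENNReal.ofReal (r ^ n) = ENNReal.ofReal (a ^ (n + 1) / (n + 1)) := by
  rw [Measure.restrict_congr_set Ioo_ae_eq_Ioc, ← ofReal_integral_eq_lintegral_ofReal
    (intervalIntegral.intervalIntegrable_pow n).1, ← intervalIntegral.integral_of_le ha]
  · simp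
  · filter_upwards [ae_restrict_mem measurableSet_Ioc] with y hy
    exact pow_nonneg hy.1.le _

theorem sqrt_pow_mul_inv_sqrt_cube {x : ℝ} (hx : 0 < x) (d : ℕ) :
    √x ^ (d + 1) / √x ^ 3 = x ^ ((d : ℝ) / 2 - 1) := by
  rw [Real.sqrt_eq_rpow, ← Real.rpow_natCast, ← Real.rpow_natCast, ← Real.rpow_mul hx.le,
    ← Real.rpow_mul hx.le, ← Real.rpow_sub hx]
  congr 1
  push_cast
  ring

theorem EuclideanSpace.setLIntegral_ball_comp_div_norm {d : ℕ} (hd : 1 ≤ d) {F : ℝ → ℝ≥0∞}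
    (hF : Measurable F) :
    ∫⁻ y in Metric.ball (0 : EuclideanSpace ℝ (Fin (d + 1))) 1, F (y 0 / ‖y‖) =
      d * volume (Metric.ball (0 : EuclideanSpace ℝ (Fin d)) 1) *
        ∫⁻ w in Set.Ioo (-1 : ℝ) 1,
          ENNReal.ofReal ((1 - w ^ 2) ^ ((d : ℝ) / 2 - 1) / (d + 1)) * F w := by
  have : Nonempty (Fin d) := ⟨⟨0, hd⟩⟩
  let H : ℝ → ℝ → ℝ≥0∞ := fun w ρ ↦ (Set.Iio (1 : ℝ)).indicator (fun _ ↦ F w) ρ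
  have hH : Measurable (Function.uncurry H) :=
    (hF.comp measurable_fst).indicator (measurable_snd measurableSet_Iio)
  have hH' : Measurable (Function.uncurry fun s ρ ↦ H (s / ρ) ρ) :=
    hH.comp (f := fun q : ℝ × ℝ ↦ (q.1 / q.2, q.2)) (by fun_prop)
  have hG : Measurable fun r : ℝ ↦ ∫⁻ s : ℝ, H (s / √(s ^ 2 + r ^ 2)) √(s ^ 2 + r ^ 2) :=
    Measurable.lintegral_prod_right' (f := fun q : ℝ × ℝ ↦
      H (q.2 / √(q.2 ^ 2 + q.1 ^ 2)) √(q.2 ^ 2 + q.1 ^ 2))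
      (hH'.comp (f := fun q : ℝ × ℝ ↦ (q.2, √(q.2 ^ 2 + q.1 ^ 2))) (by fun_prop))
  have hK : Measurable fun q : ℝ × ℝ ↦ ENNReal.ofReal (q.1 ^ (d - 1)) *
      (ENNReal.ofReal (q.1 / √(1 - q.2 ^ 2) ^ 3) * H q.2 (q.1 / √(1 - q.2 ^ 2))) := by
    refine Measurable.mul (by fun_prop) (Measurable.mul (by fun_prop) ?_)
    exact hH.comp (f := fun q : ℝ × ℝ ↦ (q.2, q.1 / √(1 - q.2 ^ 2))) (by fun_prop)
  have hball : ∫⁻ y in Metric.ball (0 : EuclideanSpace ℝ (Fin (d + 1))) 1, F (y 0 / ‖y‖) =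
      ∫⁻ y : EuclideanSpace ℝ (Fin (d + 1)), H (y 0 / ‖y‖) ‖y‖ := by
    rw [← lintegral_indicator measurableSet_ball]
    simp [H, Set.indicator]
  rw [hball, EuclideanSpace.lintegral_succ (H := fun s ρ ↦ H (s / ρ) ρ) hH',
    lintegral_fun_norm_addHaar volume hG, finrank_euclideanSpace_fin]
  congr 1
  calc _ = ∫⁻ r in Set.Ioi (0 : ℝ), ∫⁻ w in Set.Ioo (-1 : ℝ) 1, ENNReal.ofReal (r ^ (d - 1)) *
          (ENNReal.ofReal (r / √(1 - w ^ 2) ^ 3) * H w (r / √(1 - w ^ 2))) := by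
        refine setLIntegral_congr_fun measurableSet_Ioi fun r hr ↦ ?_
        rw [lintegral_div_sqrt_sq_add_sq hr, lintegral_const_mul' _ _ ENNReal.ofReal_ne_top]
    _ = _ := by
        rw [lintegral_lintegral_swap hK.aemeasurable]
        refine setLIntegral_congr_fun measurableSet_Ioo fun w hw ↦ ?_
        have h : 0 < 1 - w ^ 2 := by nlinarith [hw.1, hw.2]
        have hs : 0 < √(1 - w ^ 2) := Real.sqrt_pos.2 h
        calc _ = ∫⁻ r in Set.Ioi (0 : ℝ), (Set.Iio √(1 - w ^ 2)).indicator (fun r ↦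
                ENNReal.ofReal (r ^ d) * (ENNReal.ofReal (1 / √(1 - w ^ 2) ^ 3) * F w)) r := by
              refine setLIntegral_congr_fun measurableSet_Ioi fun r hr ↦ ?_
              have hr : 0 < r := hr
              by_cases hlt : r < √(1 - w ^ 2)
              · simp only [H, Set.indicator, Set.mem_Iio, div_lt_one hs, hlt, if_true]
                rw [← mul_assoc, ← mul_assoc, ← ENNReal.ofReal_mul (by positivity),
                  ← ENNReal.ofReal_mul (by positivity)]
                congr 2
                rw [← mul_div_assoc, ← pow_succ, Nat.sub_add_cancel hd, mul_one_div]
              · simp [H, Set.indicator, div_lt_one hs, hlt]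
          _ = (∫⁻ r in Set.Ioo 0 √(1 - w ^ 2), ENNReal.ofReal (r ^ d)) *
                (ENNReal.ofReal (1 / √(1 - w ^ 2) ^ 3) * F w) := by
              rw [setLIntegral_indicator measurableSet_Iio, Set.inter_comm, Set.Ioi_inter_Iio,
                lintegral_mul_const _ (by fun_prop)]
          _ = _ := by
              rw [setLIntegral_Ioo_pow hs.le, ← mul_assoc,
                ← ENNReal.ofReal_mul (by positivity), ← sqrt_pow_mul_inv_sqrt_cube h]
              congr 2
              ring

theorem LinearIsometryEquiv.lintegral_inner_eq_of_norm_eq {E : Type*} [NormedAddCommGroup E]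
    [InnerProductSpace ℝ E] [MeasurableSpace E] [BorelSpace E] [FiniteDimensional ℝ E]
    {ν : Measure E} (hν : ∀ g : E ≃ₗᵢ[ℝ] E, ν.map g = ν) {u v : E} (h : ‖u‖ = ‖v‖)
    (H : ℝ → ℝ → ℝ≥0∞) :
    ∫⁻ x, H ⟪u, x⟫ ‖x‖ ∂ν = ∫⁻ x, H ⟪v, x⟫ ‖x‖ ∂ν := by
  let g : E ≃ₗᵢ[ℝ] E := (ℝ ∙ (u - v))ᗮ.reflection
  have hg : g u = v := Submodule.reflection_sub h
  have hp : MeasurePreserving g ν ν := ⟨g.continuous.measurable, hν g⟩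
  rw [← hp.lintegral_comp_emb g.toHomeomorph.measurableEmbedding (fun x ↦ H ⟪v, x⟫ ‖x‖), ← hg]
  simp

theorem lintegral_inner_mul_volume_ball {E : Type*} [NormedAddCommGroup E]
    [InnerProductSpace ℝ E] [MeasurableSpace E] [BorelSpace E] [FiniteDimensional ℝ E]
    [Nontrivial E] {σ : Measure E} [IsProbabilityMeasure σ]
    (hσsph : ∀ᵐ x ∂σ, ‖x‖ = 1) (hσinv : ∀ g : E ≃ₗᵢ[ℝ] E, σ.map g = σ)
    {v : E} (hv : ‖v‖ = 1) {F : ℝ → ℝ≥0∞} (hF : Measurable F) :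
    (∫⁻ x, F ⟪v, x⟫ ∂σ) * volume (Metric.ball (0 : E) 1) =
      ∫⁻ y in Metric.ball (0 : E) 1, F (⟪v, y⟫ / ‖y‖) := by
  have hmeas : Measurable (Function.uncurry fun y x : E ↦ F (⟪y, x⟫ / ‖y‖)) :=
    hF.comp (f := fun q : E × E ↦ ⟪q.1, q.2⟫ / ‖q.1‖) (by fun_prop)
  have hball (u : E) : ∫⁻ y in Metric.ball (0 : E) 1, F (⟪u, y⟫ / ‖y‖) =
      ∫⁻ y, (fun s ρ ↦ (Set.Iio (1 : ℝ)).indicator (fun ρ ↦ F (s / ρ)) ρ) ⟪u, y⟫ ‖y‖ := by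
    rw [← lintegral_indicator measurableSet_ball]
    simp [Set.indicator]
  calc (∫⁻ x, F ⟪v, x⟫ ∂σ) * volume (Metric.ball (0 : E) 1)
      = ∫⁻ y in Metric.ball (0 : E) 1, ∫⁻ x, F ⟪v, x⟫ ∂σ := by simp
    _ = ∫⁻ y in Metric.ball (0 : E) 1, ∫⁻ x, F (⟪y, x⟫ / ‖y‖) ∂σ := by
        refine lintegral_congr_ae ?_
        filter_upwards [ae_restrict_of_ae (Measure.ae_ne volume (0 : E))] with y hy
        have : ‖v‖ = ‖(‖y‖⁻¹ • y : E)‖ := by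
          rw [hv, norm_smul, norm_inv, norm_norm, inv_mul_cancel₀ (norm_ne_zero_iff.2 hy)]
        rw [LinearIsometryEquiv.lintegral_inner_eq_of_norm_eq hσinv this fun s _ ↦ F s]
        simp [inner_smul_left, div_eq_inv_mul]
    _ = ∫⁻ x, (∫⁻ y in Metric.ball (0 : E) 1, F (⟪y, x⟫ / ‖y‖)) ∂σ :=
        lintegral_lintegral_swap hmeas.aemeasurable
    _ = ∫⁻ _, (∫⁻ y in Metric.ball (0 : E) 1, F (⟪v, y⟫ / ‖y‖)) ∂σ := by
        refine lintegral_congr_ae ?_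
        filter_upwards [hσsph] with x hx
        simp_rw [fun y : E ↦ real_inner_comm x y]
        rw [hball, hball]
        exact LinearIsometryEquiv.lintegral_inner_eq_of_norm_eq
          (fun g ↦ g.measurePreserving.map_eq) (hx.trans hv.symm)
          fun s ρ ↦ (Set.Iio (1 : ℝ)).indicator (fun ρ ↦ F (s / ρ)) ρ
    _ = _ := by simp

theorem varpi_div_varpi {d : ℕ} (hd : 1 ≤ d) :
    varpi ((d : ℝ) - 1) / varpi d =
      d * (√π ^ d / Gamma (d / 2 + 1)) / (d + 1) /
        (√π ^ (d + 1) / Gamma (((d + 1 : ℕ) : ℝ) / 2 + 1)) := by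
  have hd0 : (0 : ℝ) < d := by exact_mod_cast hd
  have hsq (n : ℕ) : √π ^ n = π ^ ((n : ℝ) / 2) := by
    rw [Real.sqrt_eq_rpow, ← Real.rpow_natCast, ← Real.rpow_mul pi_pos.le]
    congr 1
    ring
  have h1 := Real.Gamma_add_one (s := (d : ℝ) / 2) (by positivity)
  have h2 := Real.Gamma_add_one (s := ((d : ℝ) + 1) / 2) (by positivity)
  have g1 := (Real.Gamma_pos_of_pos (s := (d : ℝ) / 2) (by positivity)).ne'
  have g2 := (Real.Gamma_pos_of_pos (s := ((d : ℝ) + 1) / 2) (by positivity)).ne'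
  have p1 := (Real.rpow_pos_of_pos pi_pos ((d : ℝ) / 2)).ne'
  have p2 := (Real.rpow_pos_of_pos pi_pos (((d : ℝ) + 1) / 2)).ne'
  rw [hsq, hsq, varpi, varpi, sub_add_cancel]
  push_cast
  rw [h1, h2]
  field_simp

theorem varpi_pos {k : ℝ} (hk : -1 < k) : 0 < varpi k := by
  have := Real.Gamma_pos_of_pos (s := (k + 1) / 2) (by linarith)
  unfold varpi
  positivity

theorem lintegral_inner_sphere {d : ℕ} (hd : 1 ≤ d)
    {σ : Measure (EuclideanSpace ℝ (Fin (d + 1)))} [IsProbabilityMeasure σ]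
    (hσsph : ∀ᵐ x ∂σ, ‖x‖ = 1)
    (hσinv : ∀ g : EuclideanSpace ℝ (Fin (d + 1)) ≃ₗᵢ[ℝ] EuclideanSpace ℝ (Fin (d + 1)),
      σ.map g = σ)
    {v : EuclideanSpace ℝ (Fin (d + 1))} (hv : ‖v‖ = 1) {F : ℝ → ℝ≥0∞} (hF : Measurable F) :
    ∫⁻ x, F ⟪v, x⟫ ∂σ = ∫⁻ w in Set.Ioo (-1 : ℝ) 1, ENNReal.ofReal
      (varpi ((d : ℝ) - 1) / varpi d * (1 - w ^ 2) ^ ((d : ℝ) / 2 - 1)) * F w := by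
  have : Nonempty (Fin d) := ⟨⟨0, hd⟩⟩
  let e₀ : EuclideanSpace ℝ (Fin (d + 1)) := EuclideanSpace.single 0 1
  have he₀ : ‖e₀‖ = 1 := by simp [e₀]
  have hA : 0 < √π ^ d / Gamma ((d : ℝ) / 2 + 1) :=
    div_pos (by positivity) (Real.Gamma_pos_of_pos (by positivity))
  have hB : 0 < √π ^ (d + 1) / Gamma (((d + 1 : ℕ) : ℝ) / 2 + 1) :=
    div_pos (by positivity) (Real.Gamma_pos_of_pos (by positivity))
  have key := lintegral_inner_mul_volume_ball hσsph hσinv he₀ hF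
  have hinner (y : EuclideanSpace ℝ (Fin (d + 1))) : ⟪e₀, y⟫ = y 0 := by
    simp [e₀, EuclideanSpace.inner_single_left]
  rw [← LinearIsometryEquiv.lintegral_inner_eq_of_norm_eq hσinv (he₀.trans hv.symm)
    fun s _ ↦ F s]
  simp only [hinner] at key ⊢
  rw [EuclideanSpace.setLIntegral_ball_comp_div_norm hd hF, EuclideanSpace.volume_ball,
    EuclideanSpace.volume_ball] at key
  simp only [ENNReal.ofReal_one, one_pow, one_mul, Fintype.card_fin] at key
  rw [← ENNReal.mul_left_inj (ENNReal.ofReal_pos.2 hB).ne' ENNReal.ofReal_ne_top, key,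
    ← ENNReal.ofReal_natCast, ← ENNReal.ofReal_mul (by positivity),
    ← lintegral_const_mul' _ _ ENNReal.ofReal_ne_top,
    ← lintegral_mul_const' _ _ ENNReal.ofReal_ne_top]
  refine setLIntegral_congr_fun measurableSet_Ioo fun w hw ↦ ?_
  have h : 0 < 1 - w ^ 2 := by nlinarith [hw.1, hw.2]
  rw [mul_right_comm, ← mul_assoc, ← ENNReal.ofReal_mul (by positivity),
    ← ENNReal.ofReal_mul' hB.le, varpi_div_varpi hd]
  congr 2
  field_simp

theorem integral_inner_sphere {d : ℕ} (hd : 1 ≤ d)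
    {σ : Measure (EuclideanSpace ℝ (Fin (d + 1)))} [IsProbabilityMeasure σ]
    (hσsph : ∀ᵐ x ∂σ, ‖x‖ = 1)
    (hσinv : ∀ g : EuclideanSpace ℝ (Fin (d + 1)) ≃ₗᵢ[ℝ] EuclideanSpace ℝ (Fin (d + 1)),
      σ.map g = σ)
    {v : EuclideanSpace ℝ (Fin (d + 1))} (hv : ‖v‖ = 1) {f : ℝ → ℝ} (hf : Measurable f) :
    ∫ x, f ⟪v, x⟫ ∂σ = varpi ((d : ℝ) - 1) / varpi d *
      ∫ w in (-1 : ℝ)..1, f w * (1 - w ^ 2) ^ ((d : ℝ) / 2 - 1) := by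
  have hd0 : (1 : ℝ) ≤ d := by exact_mod_cast hd
  have hK : 0 ≤ varpi ((d : ℝ) - 1) / varpi d :=
    div_nonneg (varpi_pos (by linarith)).le (varpi_pos (by linarith)).le
  have hmeas : Measurable fun w : ℝ ↦ ENNReal.ofReal
      (varpi ((d : ℝ) - 1) / varpi d * (1 - w ^ 2) ^ ((d : ℝ) / 2 - 1)) := by fun_prop
  have hin : Measurable fun x : EuclideanSpace ℝ (Fin (d + 1)) ↦ ⟪v, x⟫ := by fun_prop
  have hmap : σ.map (fun x ↦ ⟪v, x⟫) = (volume.restrict (Set.Ioo (-1 : ℝ) 1)).withDensity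
      fun w ↦ ENNReal.ofReal
        (varpi ((d : ℝ) - 1) / varpi d * (1 - w ^ 2) ^ ((d : ℝ) / 2 - 1)) := by
    refine Measure.ext_of_lintegral _ fun F hF ↦ ?_
    rw [lintegral_map hF hin, lintegral_withDensity_eq_lintegral_mul _ hmeas hF,
      lintegral_inner_sphere hd hσsph hσinv hv hF]
    rfl
  rw [← integral_map hin.aemeasurable hf.aestronglyMeasurable, hmap,
    integral_withDensity_eq_integral_toReal_smul hmeas (by simp),
    intervalIntegral.integral_of_le (by norm_num), ← integral_Ioc_eq_integral_Ioo,
    ← integral_const_mul]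
  refine setIntegral_congr_fun measurableSet_Ioc fun w hw ↦ ?_
  have h : 0 ≤ 1 - w ^ 2 := by nlinarith [hw.1, hw.2]
  simp only [smul_eq_mul]
  rw [ENNReal.toReal_ofReal (by positivity)]
  ring

theorem stmt_1
    {M : Type*} [MeasurableSpace M] (μ : Measure M) [IsProbabilityMeasure μ]
    (d : ℕ) (hd : 1 ≤ d)
    (e : Fin (d + 1) → M → ℝ)
    (hmeas : ∀ i, Measurable (e i))
    (horth : ∀ i j, ∫ p, e i p * e j p ∂μ = if i = j then 1 else 0)
    (hdiag : ∀ p, ∑ i, (e i p) ^ 2 = (d : ℝ) + 1)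
    (σ : Measure (EuclideanSpace ℝ (Fin (d + 1)))) [IsProbabilityMeasure σ]
    (hσsph : σ (Metric.sphere (0 : EuclideanSpace ℝ (Fin (d + 1))) 1) = 1)
    (hσinv : ∀ g : EuclideanSpace ℝ (Fin (d + 1)) ≃ₗᵢ[ℝ] EuclideanSpace ℝ (Fin (d + 1)),
      σ.map g = σ)
    (f : ℝ → ℝ) (hf : Measurable f) (hfb : ∃ C, ∀ s : ℝ, |f s| ≤ C) :
    ∫ x, (∫ p, f (∑ i, x i * e i p) ∂μ) ∂σ
      = varpi ((d : ℝ) - 1) / (Real.sqrt ((d : ℝ) + 1) * varpi d) *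
          ∫ s in (-Real.sqrt ((d : ℝ) + 1))..(Real.sqrt ((d : ℝ) + 1)),
            f s * (1 - s ^ 2 / ((d : ℝ) + 1)) ^ ((d : ℝ) / 2 - 1) := by
  have hd0 : (0 : ℝ) < (d : ℝ) + 1 := by positivity
  obtain ⟨C, hC⟩ := hfb
  have hσ : ∀ᵐ x ∂σ, ‖x‖ = 1 := by
    filter_upwards [(mem_ae_iff_prob_eq_one Metric.isClosed_sphere.measurableSet).2 hσsph]
      with x hx using mem_sphere_zero_iff_norm.1 hx
  set c := √((d : ℝ) + 1) with hc
  have hc0 : 0 < c := Real.sqrt_pos.2 hd0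
  have hc2 : c ^ 2 = (d : ℝ) + 1 := Real.sq_sqrt hd0.le
  have hmeas2 : Measurable (Function.uncurry fun (x : EuclideanSpace ℝ (Fin (d + 1))) p ↦
      f (∑ i, x i * e i p)) :=
    hf.comp (f := fun q : EuclideanSpace ℝ (Fin (d + 1)) × M ↦ ∑ i, q.1 i * e i q.2)
      (by fun_prop)
  have hint : Integrable (Function.uncurry fun (x : EuclideanSpace ℝ (Fin (d + 1))) p ↦
      f (∑ i, x i * e i p)) (σ.prod μ) :=
    Integrable.of_bound hmeas2.aestronglyMeasurable C (ae_of_all _ fun q ↦ hC _)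
  have hinner (p : M) : ∫ x, f (∑ i, x i * e i p) ∂σ = varpi ((d : ℝ) - 1) / varpi d *
      ∫ w in (-1 : ℝ)..1, f (c * w) * (1 - w ^ 2) ^ ((d : ℝ) / 2 - 1) := by
    have hv : ‖(c⁻¹ • WithLp.toLp 2 fun i ↦ e i p : EuclideanSpace ℝ (Fin (d + 1)))‖ = 1 := by
      rw [norm_smul, EuclideanSpace.norm_eq]
      simp [hdiag, ← hc, abs_of_pos hc0, hc0.ne']
    rw [← integral_inner_sphere hd hσ hσinv hv (f := fun w ↦ f (c * w)) (by fun_prop)]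
    refine integral_congr_ae (ae_of_all _ fun x ↦ ?_)
    simp [inner_smul_left, PiLp.inner_apply, hc0.ne']
  rw [integral_integral_swap hint]
  simp only [hinner, integral_const, probReal_univ, one_smul]
  have hsub := intervalIntegral.mul_integral_comp_mul_left (a := -1) (b := 1) (c := c)
    (f := fun s ↦ f s * (1 - s ^ 2 / ((d : ℝ) + 1)) ^ ((d : ℝ) / 2 - 1))
  rw [mul_neg_one, mul_one] at hsub
  rw [← hsub, ← hc2]
  simp only [mul_pow, mul_div_cancel_left₀ _ (pow_ne_zero 2 hc0.ne')]
  field_simp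
end

section
/- Let (M, μ) be a probability space, d ≥ 1, and e_0, …, e_d : M → ℝ measurable functions forming an orthonormal family in L²(μ) and satisfying ∑_{i=0}^d e_i(p)² = d + 1 for every p ∈ M. Let S^d be the unit sphere of ℝ^{d+1} with its rotation-invariant probability measure σ, and for x ∈ S^d set u_x = ∑_{i=0}^d x_i e_i. Then for every real a > −1: the function x ↦ ∫_M |u_x(p)|^a dμ(p) (with values in [0, ∞]) is σ-integrable — in particular ∫_M |u_x(p)|^a dμ(p) is finite for σ-almost every x — and ∫_{S^d} (∫_M |u_x(p)|^a dμ(p)) dσ(x) = Γ((a+1)/2) Γ((d+1)/2) (d+1)^{a/2} / (√π · Γ((a+d+1)/2)). -/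
open MeasureTheory Real Filter

lemma pow_pred_smul_rpow_mul_exp {n : ℕ} (hn : 0 < n) (a : ℝ) {r : ℝ} (hr : 0 < r) :
    r ^ (n - 1) • (r ^ a * exp (-r ^ 2)) = r ^ (a + n - 1) * exp (-r ^ (2 : ℝ)) := by
  have h : a + n - 1 = ((n - 1 : ℕ) : ℝ) + a := by
    rw [Nat.cast_pred hn]; ring
  rw [h, rpow_add hr, rpow_natCast, rpow_two, smul_eq_mul, mul_assoc]

section NormPowers

variable {E : Type*} [NormedAddCommGroup E] [InnerProductSpace ℝ E] [FiniteDimensional ℝ E]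
  [MeasurableSpace E] [BorelSpace E] [Nontrivial E]

lemma integrable_norm_rpow_mul_exp_neg_norm_sq {a : ℝ} (ha : -(Module.finrank ℝ E : ℝ) < a) :
    Integrable fun v : E => ‖v‖ ^ a * exp (-‖v‖ ^ 2) := by
  refine (integrable_fun_norm_addHaar volume (f := fun r : ℝ => r ^ a * exp (-r ^ 2))).2 ?_
  refine (integrableOn_rpow_mul_exp_neg_rpow (p := 2) (s := a + Module.finrank ℝ E - 1)
    (by linarith) two_pos).congr_fun (fun r hr => ?_) measurableSet_Ioi
  exact (pow_pred_smul_rpow_mul_exp Module.finrank_pos a hr).symm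

lemma integral_norm_rpow_mul_exp_neg_norm_sq {a : ℝ} (ha : -(Module.finrank ℝ E : ℝ) < a) :
    ∫ v : E, ‖v‖ ^ a * exp (-‖v‖ ^ 2) =
      √π ^ Module.finrank ℝ E * Gamma ((a + Module.finrank ℝ E) / 2) /
        Gamma (Module.finrank ℝ E / 2) := by
  have hn : (0 : ℝ) < Module.finrank ℝ E := Nat.cast_pos.2 Module.finrank_pos
  rw [integral_fun_norm_addHaar volume fun r : ℝ => r ^ a * exp (-r ^ 2),
    setIntegral_congr_fun measurableSet_Ioi fun r hr =>
      pow_pred_smul_rpow_mul_exp Module.finrank_pos a hr,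
    integral_rpow_mul_exp_neg_rpow two_pos (by linarith), measureReal_def,
    InnerProductSpace.volume_ball, ENNReal.ofReal_one, one_pow, one_mul,
    ENNReal.toReal_ofReal (by positivity), Gamma_add_one (by positivity), sub_add_cancel]
  have := (Gamma_pos_of_pos (half_pos hn)).ne'
  simp only [smul_eq_mul, nsmul_eq_mul]
  field_simp

end NormPowers

section Coordinate

variable {d : ℕ} {a : ℝ}

lemma abs_coord_rpow_mul_exp_neg_norm_sq (a : ℝ) (x : EuclideanSpace ℝ (Fin (d + 1))) :
    |x 0| ^ a * exp (-‖x‖ ^ 2) =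
      ∏ i, |x i| ^ (if i = 0 then a else 0) * exp (-|x i| ^ 2) := by
  rw [Finset.prod_mul_distrib, ← exp_sum, Finset.sum_neg_distrib, EuclideanSpace.norm_sq_eq]
  simp

lemma neg_finrank_real_lt_ite (ha : -1 < a) (i : Fin (d + 1)) :
    -(Module.finrank ℝ ℝ : ℝ) < if i = 0 then a else 0 := by
  split_ifs <;> simp [ha]

lemma integrable_abs_coord_rpow_mul_exp_neg_norm_sq (ha : -1 < a) :
    Integrable fun x : EuclideanSpace ℝ (Fin (d + 1)) => |x 0| ^ a * exp (-‖x‖ ^ 2) := by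
  simp_rw [abs_coord_rpow_mul_exp_neg_norm_sq]
  refine (EuclideanSpace.volume_preserving_symm_measurableEquiv_toLp _).integrable_comp_of_integrable
    (g := fun y : Fin (d + 1) → ℝ => ∏ i, |y i| ^ (if i = 0 then a else 0) * exp (-|y i| ^ 2)) ?_
  exact Integrable.fintype_prod
    (f := fun (i : Fin (d + 1)) (t : ℝ) => |t| ^ (if i = 0 then a else 0) * exp (-|t| ^ 2))
    fun i => integrable_norm_rpow_mul_exp_neg_norm_sq (E := ℝ) (neg_finrank_real_lt_ite ha i)

lemma integral_abs_coord_rpow_mul_exp_neg_norm_sq (ha : -1 < a) :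
    ∫ x : EuclideanSpace ℝ (Fin (d + 1)), |x 0| ^ a * exp (-‖x‖ ^ 2) =
      Gamma ((a + 1) / 2) * √π ^ d := by
  simp_rw [abs_coord_rpow_mul_exp_neg_norm_sq]
  refine ((EuclideanSpace.volume_preserving_symm_measurableEquiv_toLp (Fin (d + 1))).integral_comp'
    fun y : Fin (d + 1) → ℝ => ∏ i, |y i| ^ (if i = 0 then a else 0) * exp (-|y i| ^ 2)).trans ?_
  rw [integral_fintype_prod_volume_eq_prod
      fun (i : Fin (d + 1)) (t : ℝ) => |t| ^ (if i = 0 then a else 0) * exp (-|t| ^ 2)]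
  have h (i : Fin (d + 1)) := integral_norm_rpow_mul_exp_neg_norm_sq (E := ℝ)
    (neg_finrank_real_lt_ite ha i)
  simp only [norm_eq_abs] at h
  have hpi : √π ≠ 0 := (sqrt_pos.2 pi_pos).ne'
  simp_rw [h, Fin.prod_univ_succ]
  simp
  field_simp
  rw [Gamma_one_half_eq]
  ring

end Coordinate

section Invariant

open scoped RealInnerProductSpace

variable {E : Type*} [NormedAddCommGroup E] [InnerProductSpace ℝ E] [MeasurableSpace E]
  [BorelSpace E]

lemma lintegral_abs_inner_rpow_of_invariant [CompleteSpace E] {ν : Measure E}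
    (hν : ∀ g : E ≃ₗᵢ[ℝ] E, MeasurePreserving g ν ν) (a : ℝ) {u : E} (hu : ‖u‖ = 1) (v : E) :
    ∫⁻ x, ENNReal.ofReal (|⟪x, v⟫| ^ a) ∂ν =
      ENNReal.ofReal (‖v‖ ^ a) * ∫⁻ x, ENNReal.ofReal (|⟪x, u⟫| ^ a) ∂ν := by
  obtain ⟨g, hg⟩ : ∃ g : E ≃ₗᵢ[ℝ] E, g (‖v‖ • u) = v :=
    ⟨_, Submodule.reflection_sub (by simp [norm_smul, hu])⟩
  rw [← (hν g).lintegral_comp_emb g.toHomeomorph.measurableEmbedding,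
    ← lintegral_const_mul' _ _ ENNReal.ofReal_ne_top]
  refine lintegral_congr fun x => ?_
  nth_rewrite 1 [← hg]
  rw [g.inner_map_map, real_inner_smul_right, abs_mul, abs_norm,
    mul_rpow (norm_nonneg _) (abs_nonneg _), ENNReal.ofReal_mul (by positivity)]

lemma measurePreserving_withDensity_norm [FiniteDimensional ℝ E] {f : ℝ → ENNReal}
    (g : E ≃ₗᵢ[ℝ] E) :
    MeasurePreserving g ((volume : Measure E).withDensity fun x => f ‖x‖)
      ((volume : Measure E).withDensity fun x => f ‖x‖) := by
  refine ⟨g.continuous.measurable, Measure.ext fun s hs => ?_⟩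
  have hg := g.continuous.measurable hs
  rw [Measure.map_apply g.continuous.measurable hs, withDensity_apply _ hg, withDensity_apply _ hs,
    ← g.measurePreserving.setLIntegral_comp_preimage_emb g.toHomeomorph.measurableEmbedding _ s]
  simp

end Invariant

open scoped RealInnerProductSpace in
lemma lintegral_sphere_abs_coord_rpow {d : ℕ} {a : ℝ} (ha : -1 < a)
    (σ : Measure (EuclideanSpace ℝ (Fin (d + 1)))) [IsProbabilityMeasure σ]
    (hσ : ∀ᵐ x ∂σ, ‖x‖ = 1)
    (hinv : ∀ g : EuclideanSpace ℝ (Fin (d + 1)) ≃ₗᵢ[ℝ] EuclideanSpace ℝ (Fin (d + 1)),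
      MeasurePreserving g σ σ) :
    ∫⁻ x, ENNReal.ofReal (|x 0| ^ a) ∂σ =
      ENNReal.ofReal (Gamma ((a + 1) / 2) * Gamma (((d : ℝ) + 1) / 2) /
        (√π * Gamma ((a + d + 1) / 2))) := by
  let f : ℝ → ENNReal := fun r => ENNReal.ofReal (exp (-r ^ 2))
  let γ : Measure (EuclideanSpace ℝ (Fin (d + 1))) := volume.withDensity fun x => f ‖x‖
  let u : EuclideanSpace ℝ (Fin (d + 1)) := EuclideanSpace.single 0 1
  have hf : Measurable fun x : EuclideanSpace ℝ (Fin (d + 1)) => f ‖x‖ := by fun_prop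
  have hu : ‖u‖ = 1 := by simp [u]
  have hinner (x : EuclideanSpace ℝ (Fin (d + 1))) : ⟪x, u⟫ = x 0 := by
    simp [u, EuclideanSpace.inner_single_right]
  have hγ_lint {φ : EuclideanSpace ℝ (Fin (d + 1)) → ℝ} (hφ : Measurable φ) (h0 : ∀ x, 0 ≤ φ x)
      (hint : Integrable fun x : EuclideanSpace ℝ (Fin (d + 1)) => φ x * exp (-‖x‖ ^ 2)) :
      ∫⁻ x, ENNReal.ofReal (φ x) ∂γ =
        ENNReal.ofReal (∫ x : EuclideanSpace ℝ (Fin (d + 1)), φ x * exp (-‖x‖ ^ 2)) := by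
    rw [lintegral_withDensity_eq_lintegral_mul _ hf hφ.ennreal_ofReal,
      ofReal_integral_eq_lintegral_ofReal hint
        (Eventually.of_forall fun x => mul_nonneg (h0 x) (exp_nonneg _))]
    refine lintegral_congr fun x => ?_
    rw [ENNReal.ofReal_mul (h0 x), Pi.mul_apply, mul_comm]
  have hdim : Module.finrank ℝ (EuclideanSpace ℝ (Fin (d + 1))) = d + 1 := by simp
  have had : -(Module.finrank ℝ (EuclideanSpace ℝ (Fin (d + 1))) : ℝ) < a := by
    rw [hdim]; push_cast; linarith [(Nat.cast_nonneg d : (0 : ℝ) ≤ d)]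
  have hcoord : ∫⁻ x : EuclideanSpace ℝ (Fin (d + 1)), ENNReal.ofReal (|x 0| ^ a) ∂γ =
      ENNReal.ofReal (Gamma ((a + 1) / 2) * √π ^ d) := by
    rw [hγ_lint (by fun_prop) (fun x => by positivity)
      (integrable_abs_coord_rpow_mul_exp_neg_norm_sq ha),
      integral_abs_coord_rpow_mul_exp_neg_norm_sq ha]
  have hnorm : ∫⁻ x : EuclideanSpace ℝ (Fin (d + 1)), ENNReal.ofReal (‖x‖ ^ a) ∂γ =
      ENNReal.ofReal (√π ^ (d + 1) * Gamma ((a + d + 1) / 2) / Gamma (((d : ℝ) + 1) / 2)) := by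
    rw [hγ_lint (by fun_prop) (fun x => by positivity)
      (integrable_norm_rpow_mul_exp_neg_norm_sq had),
      integral_norm_rpow_mul_exp_neg_norm_sq had, hdim]
    push_cast
    rw [add_assoc]
  have hswap : ∫⁻ v, ∫⁻ x, ENNReal.ofReal (|⟪x, v⟫| ^ a) ∂σ ∂γ =
      ∫⁻ x, ∫⁻ v, ENNReal.ofReal (|⟪v, x⟫| ^ a) ∂γ ∂σ := by
    rw [lintegral_lintegral_swap (by fun_prop)]
    exact lintegral_congr fun x => lintegral_congr fun v => by rw [real_inner_comm]
  rw [lintegral_congr fun v => lintegral_abs_inner_rpow_of_invariant hinv a hu v,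
    lintegral_congr fun x => lintegral_abs_inner_rpow_of_invariant (ν := γ)
      (fun g => measurePreserving_withDensity_norm g) a hu x] at hswap
  simp_rw [hinner] at hswap
  rw [lintegral_mul_const _ (by fun_prop), lintegral_mul_const _ (by fun_prop), hcoord, hnorm,
    lintegral_congr_ae (f := fun x => ENNReal.ofReal (‖x‖ ^ a)) (g := fun _ => 1)
      (hσ.mono fun x hx => by simp [hx]), lintegral_one,
    measure_univ, one_mul] at hswap
  have h1 : 0 < Gamma ((a + d + 1) / 2) := Gamma_pos_of_pos (by
    linarith [(Nat.cast_nonneg d : (0 : ℝ) ≤ d)])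
  have h2 : 0 < Gamma (((d : ℝ) + 1) / 2) := Gamma_pos_of_pos (by positivity)
  have h3 : 0 < √π := sqrt_pos.2 pi_pos
  have hpos : 0 < √π ^ (d + 1) * Gamma ((a + d + 1) / 2) / Gamma (((d : ℝ) + 1) / 2) := by
    positivity
  rw [← ENNReal.mul_right_inj (ENNReal.ofReal_pos.2 hpos).ne' ENNReal.ofReal_ne_top, hswap,
    ← ENNReal.ofReal_mul hpos.le]
  congr 1
  field_simp
  ring

theorem stmt_2
    {M : Type*} [MeasurableSpace M] (μ : Measure M) [IsProbabilityMeasure μ]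
    (d : ℕ) (hd : 1 ≤ d)
    (e : Fin (d + 1) → M → ℝ)
    (hmeas : ∀ i, Measurable (e i))
    (horth : ∀ i j, ∫ p, e i p * e j p ∂μ = if i = j then 1 else 0)
    (hdiag : ∀ p, ∑ i, (e i p) ^ 2 = (d : ℝ) + 1)
    (σ : Measure (EuclideanSpace ℝ (Fin (d + 1)))) [IsProbabilityMeasure σ]
    (hσsph : σ (Metric.sphere (0 : EuclideanSpace ℝ (Fin (d + 1))) 1) = 1)
    (hσinv : ∀ g : EuclideanSpace ℝ (Fin (d + 1)) ≃ₗᵢ[ℝ] EuclideanSpace ℝ (Fin (d + 1)),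
      σ.map g = σ)
    (a : ℝ) (ha : -1 < a) :
    (∫⁻ x, (∫⁻ p, ENNReal.ofReal (|∑ i, x i * e i p| ^ a) ∂μ) ∂σ) ≠ ⊤ ∧
    (∫⁻ x, (∫⁻ p, ENNReal.ofReal (|∑ i, x i * e i p| ^ a) ∂μ) ∂σ).toReal
      = Real.Gamma ((a + 1) / 2) * Real.Gamma (((d : ℝ) + 1) / 2) * ((d : ℝ) + 1) ^ (a / 2) /
          (Real.sqrt Real.pi * Real.Gamma ((a + (d : ℝ) + 1) / 2)) := by
  have hsph : ∀ᵐ x ∂σ, ‖x‖ = 1 := by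
    have h : ∀ᵐ x ∂σ, x ∈ Metric.sphere (0 : EuclideanSpace ℝ (Fin (d + 1))) 1 :=
      (prob_compl_eq_zero_iff Metric.isClosed_sphere.measurableSet).2 hσsph
    simpa using h
  have hinv (g : EuclideanSpace ℝ (Fin (d + 1)) ≃ₗᵢ[ℝ] EuclideanSpace ℝ (Fin (d + 1))) :
      MeasurePreserving g σ σ := ⟨g.continuous.measurable, hσinv g⟩
  let v : M → EuclideanSpace ℝ (Fin (d + 1)) := fun p => WithLp.toLp 2 fun i => e i p
  have hv (p : M) : ‖v p‖ = ((d : ℝ) + 1) ^ (1 / 2 : ℝ) := by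
    rw [EuclideanSpace.norm_eq, ← sqrt_eq_rpow, ← hdiag p]
    simp [v]
  have hinner (x : EuclideanSpace ℝ (Fin (d + 1))) (p : M) :
      ∑ i, x i * e i p = inner ℝ x (v p) := by
    simp [v, PiLp.inner_apply, mul_comm]
  have hcoord (x : EuclideanSpace ℝ (Fin (d + 1))) :
      inner ℝ x (EuclideanSpace.single 0 1) = x 0 := by
    simp [EuclideanSpace.inner_single_right]
  have hC0 : 0 ≤ Gamma ((a + 1) / 2) * Gamma (((d : ℝ) + 1) / 2) /
      (√π * Gamma ((a + d + 1) / 2)) := by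
    have hd0 : (0 : ℝ) ≤ d := d.cast_nonneg
    have h1 := Gamma_pos_of_pos (show 0 < (a + 1) / 2 by linarith)
    have h2 := Gamma_pos_of_pos (show 0 < (a + d + 1) / 2 by linarith)
    have h3 := Gamma_pos_of_pos (show 0 < ((d : ℝ) + 1) / 2 by linarith)
    positivity
  have key : ∫⁻ x, (∫⁻ p, ENNReal.ofReal (|∑ i, x i * e i p| ^ a) ∂μ) ∂σ =
      ENNReal.ofReal (((d : ℝ) + 1) ^ (a / 2) * (Gamma ((a + 1) / 2) *
        Gamma (((d : ℝ) + 1) / 2) / (√π * Gamma ((a + d + 1) / 2)))) := by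
    rw [lintegral_lintegral_swap (by fun_prop)]
    simp_rw [hinner]
    rw [lintegral_congr fun p => lintegral_abs_inner_rpow_of_invariant hinv a
      (u := EuclideanSpace.single 0 1) (by simp) (v p)]
    simp_rw [hcoord, hv, lintegral_sphere_abs_coord_rpow ha σ hsph hinv]
    rw [lintegral_const, measure_univ, mul_one, ← rpow_mul (by positivity),
      ENNReal.ofReal_mul (by positivity), one_div_mul_eq_div]
  rw [key]
  refine ⟨ENNReal.ofReal_ne_top, ?_⟩
  rw [ENNReal.toReal_ofReal (mul_nonneg (by positivity) hC0)]
  ring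
end

section
/- For a real number a > −1 and an integer d ≥ 1, set E(a,d) = Γ((a+1)/2) Γ((d+1)/2) (d+1)^{a/2} / (√π · Γ((a+d+1)/2)). Then: (i) if a > 2 or −1 < a < 0, then E(a,d) < 2^{a/2} Γ((a+1)/2)/√π; (ii) if 0 < a < 2, then E(a,d) > 2^{a/2} Γ((a+1)/2)/√π; (iii) if a = 0 or a = 2, then E(a,d) = 2^{a/2} Γ((a+1)/2)/√π. -/
open Real

theorem log_Gamma_add_one {w : ℝ} (hw : 0 < w) :
    log (Gamma (w + 1)) = log (Gamma w) + log w := by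
  rw [Gamma_add_one hw.ne', log_mul hw.ne' (Gamma_pos_of_pos hw).ne', add_comm]

theorem log_Gamma_add_le {w s : ℝ} (hw : 0 < w) (hs0 : 0 < s) (hs1 : s < 1) :
    log (Gamma (w + s)) ≤ log (Gamma w) + s * log w := by
  have h := convexOn_log_Gamma.2 (Set.mem_Ioi.2 hw) (Set.mem_Ioi.2 (by linarith : 0 < w + 1))
    (by linarith : 0 ≤ 1 - s) hs0.le (by ring)
  simp only [smul_eq_mul, Function.comp_apply, log_Gamma_add_one hw] at h
  rw [show (1 - s) * w + s * (w + 1) = w + s by ring] at h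
  linarith

theorem le_log_Gamma_add {w s : ℝ} (hw : 0 < w) (hws : 0 < w + s) (hs : 1 < s ∨ s < 0) :
    log (Gamma w) + s * log w ≤ log (Gamma (w + s)) := by
  rcases hs with hs | hs
  · have hs0 : 0 < s := by linarith
    have h := convexOn_log_Gamma.2 (Set.mem_Ioi.2 hw) (Set.mem_Ioi.2 hws)
      (sub_nonneg.2 (inv_le_one_of_one_le₀ hs.le)) (inv_nonneg.2 hs0.le) (by ring)
    simp only [smul_eq_mul, Function.comp_apply] at h
    rw [show (1 - s⁻¹) * w + s⁻¹ * (w + s) = w + 1 by field_simp; ring,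
      log_Gamma_add_one hw] at h
    have h2 := mul_le_mul_of_nonneg_left h hs0.le
    have h3 : s * ((1 - s⁻¹) * log (Gamma w) + s⁻¹ * log (Gamma (w + s)))
        = (s - 1) * log (Gamma w) + log (Gamma (w + s)) := by field_simp
    linarith
  · have hs1 : 0 < 1 - s := by linarith
    have h := convexOn_log_Gamma.2 (Set.mem_Ioi.2 hws) (Set.mem_Ioi.2 (by linarith : 0 < w + 1))
      (div_nonneg zero_le_one hs1.le) (div_nonneg (neg_nonneg.2 hs.le) hs1.le)
      (by field_simp; ring)
    simp only [smul_eq_mul, Function.comp_apply, log_Gamma_add_one hw] at h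
    rw [show 1 / (1 - s) * (w + s) + -s / (1 - s) * (w + 1) = w by field_simp; ring] at h
    have h2 := mul_le_mul_of_nonneg_left h hs1.le
    have h3 : (1 - s) * (1 / (1 - s) * log (Gamma (w + s))
        + -s / (1 - s) * (log (Gamma w) + log w))
        = log (Gamma (w + s)) - s * (log (Gamma w) + log w) := by field_simp; ring
    linarith

theorem log_one_add_one_div_rpow {w s : ℝ} (hw : 0 < w) :
    log ((1 + 1 / w) ^ s) = s * (log (w + 1) - log w) := by
  rw [log_rpow (by positivity), show 1 + 1 / w = (w + 1) / w by field_simp,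
    log_div (by positivity) hw.ne']

theorem log_one_add_mul_one_div {w s : ℝ} (hw : 0 < w) (hws : 0 < w + s) :
    log (1 + s * (1 / w)) = log (w + s) - log w := by
  rw [show 1 + s * (1 / w) = (w + s) / w by field_simp, log_div hws.ne' hw.ne']

/-- Log-convexity at `w + 1` and the strict Bernoulli inequality give the strict bound at `w`. -/
theorem Gamma_add_lt {w s : ℝ} (hw : 0 < w) (hs0 : 0 < s) (hs1 : s < 1) :
    Gamma (w + s) < Gamma w * w ^ s := by
  have hws : 0 < w + s := by linarith
  have hG := Gamma_pos_of_pos hw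
  rw [← log_lt_log_iff (Gamma_pos_of_pos hws) (by positivity),
    log_mul hG.ne' (by positivity), log_rpow hw]
  have h := log_Gamma_add_le (by linarith : 0 < w + 1) hs0 hs1
  rw [add_right_comm, log_Gamma_add_one hws, log_Gamma_add_one hw] at h
  have hw1 : 0 < 1 / w := by positivity
  have hB := rpow_one_add_lt_one_add_mul_self (s := 1 / w)
    (by linarith) hw1.ne' hs0 hs1
  have hL := log_lt_log (by positivity) hB
  rw [log_one_add_one_div_rpow hw, log_one_add_mul_one_div hw hws] at hL
  linarith

theorem lt_Gamma_add {w s : ℝ} (hw : 0 < w) (hws : 0 < w + s) (hs : 1 < s ∨ s < 0) :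
    Gamma w * w ^ s < Gamma (w + s) := by
  have hG := Gamma_pos_of_pos hw
  rw [← log_lt_log_iff (by positivity) (Gamma_pos_of_pos hws),
    log_mul hG.ne' (by positivity), log_rpow hw]
  have h := le_log_Gamma_add (by linarith : 0 < w + 1) (by linarith) hs
  rw [add_right_comm w 1 s, log_Gamma_add_one hws, log_Gamma_add_one hw] at h
  have hw1 : 0 < 1 / w := by positivity
  have hpos : 0 < 1 + s * (1 / w) := by
    rw [show 1 + s * (1 / w) = (w + s) / w by field_simp]
    positivity
  have hL : log (1 + s * (1 / w)) < log ((1 + 1 / w) ^ s) := by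
    rcases hs with hs | hs
    · exact log_lt_log hpos (one_add_mul_self_lt_rpow_one_add (by linarith) hw1.ne' hs)
    · rw [log_rpow (by positivity)]
      have hsw : s * (1 / w) < 0 := mul_neg_of_neg_of_pos hs hw1
      have h1 := log_lt_sub_one_of_pos hpos (by linarith)
      have h2 := mul_le_mul_of_nonpos_left
        (log_le_sub_one_of_pos (by positivity : 0 < 1 + 1 / w)) hs.le
      linarith
  rw [log_one_add_one_div_rpow hw, log_one_add_mul_one_div hw hws] at hL
  linarith

theorem stmt_3 (a : ℝ) (ha : -1 < a) (d : ℕ) (hd : 1 ≤ d) :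
    ((2 < a ∨ a < 0) →
      Real.Gamma ((a + 1) / 2) * Real.Gamma (((d : ℝ) + 1) / 2) * ((d : ℝ) + 1) ^ (a / 2) /
          (Real.sqrt Real.pi * Real.Gamma ((a + (d : ℝ) + 1) / 2))
        < 2 ^ (a / 2) * Real.Gamma ((a + 1) / 2) / Real.sqrt Real.pi) ∧
    (0 < a → a < 2 →
      Real.Gamma ((a + 1) / 2) * Real.Gamma (((d : ℝ) + 1) / 2) * ((d : ℝ) + 1) ^ (a / 2) /
          (Real.sqrt Real.pi * Real.Gamma ((a + (d : ℝ) + 1) / 2))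
        > 2 ^ (a / 2) * Real.Gamma ((a + 1) / 2) / Real.sqrt Real.pi) ∧
    ((a = 0 ∨ a = 2) →
      Real.Gamma ((a + 1) / 2) * Real.Gamma (((d : ℝ) + 1) / 2) * ((d : ℝ) + 1) ^ (a / 2) /
          (Real.sqrt Real.pi * Real.Gamma ((a + (d : ℝ) + 1) / 2))
        = 2 ^ (a / 2) * Real.Gamma ((a + 1) / 2) / Real.sqrt Real.pi) := by
  set z : ℝ := ((d : ℝ) + 1) / 2 with hz_def
  have hz : 0 < z := by positivity
  have hd1 : (1 : ℝ) ≤ d := by exact_mod_cast hd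
  have hzs : 0 < z + a / 2 := by rw [hz_def]; linarith
  have hGs := Gamma_pos_of_pos hzs
  have hGa : 0 < Gamma ((a + 1) / 2) := Gamma_pos_of_pos (by linarith)
  have hpi : 0 < √π := sqrt_pos.2 pi_pos
  set C : ℝ := 2 ^ (a / 2) * Gamma ((a + 1) / 2) / √π with hC_def
  have hC : 0 < C := by positivity
  have key : Gamma ((a + 1) / 2) * Gamma z * ((d : ℝ) + 1) ^ (a / 2) /
      (√π * Gamma ((a + (d : ℝ) + 1) / 2)) = C * (Gamma z * z ^ (a / 2) / Gamma (z + a / 2)) := by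
    rw [show (d : ℝ) + 1 = 2 * z by rw [hz_def]; ring, mul_rpow zero_le_two hz.le,
      show (a + (d : ℝ) + 1) / 2 = z + a / 2 by rw [hz_def]; ring, hC_def]
    field_simp
  rw [key]
  refine ⟨fun h => ?_, fun h0 h2 => ?_, fun h => ?_⟩
  · refine mul_lt_of_lt_one_right hC ((div_lt_one hGs).2 (lt_Gamma_add hz hzs ?_))
    exact h.imp (fun h => by linarith) (fun h => by linarith)
  · exact lt_mul_of_one_lt_right hC
      ((one_lt_div hGs).2 (Gamma_add_lt hz (by linarith) (by linarith)))
  · suffices Gamma z * z ^ (a / 2) = Gamma (z + a / 2) by rw [this, div_self hGs.ne', mul_one]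
    rcases h with rfl | rfl
    · simp
    · rw [div_self two_ne_zero, rpow_one, Gamma_add_one hz.ne', mul_comm]
end

section
/- Let (M, μ) be a probability space, d ≥ 1, and e_0, …, e_d : M → ℝ measurable functions forming an orthonormal family in L²(μ) and satisfying ∑_{i=0}^d e_i(p)² = d + 1 for every p ∈ M. Let S^d be the unit sphere of ℝ^{d+1} with its rotation-invariant probability measure σ, and for x ∈ S^d set u_x = ∑_{i=0}^d x_i e_i. Then for every real a ≥ 2, ∫_{S^d} (∫_M |u_x(p)|^a dμ(p))^{1/a} dσ(x) < √((a+1)/e). -/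
open MeasureTheory Real
open ProbabilityTheory
open scoped RealInnerProductSpace

lemma log_Gamma_lt_of_mem_Icc {z : ℝ} (hz : z ∈ Set.Icc (3 / 2 : ℝ) (5 / 2)) :
    log (Gamma z) < log π / 2 + (z - 1 / 2) * (log z - 1) := by
  obtain ⟨h1, h2⟩ := hz
  have hz0 : 0 < z := by linarith
  have hΓ₁ : Gamma (3 / 2) = 1 / 2 * √π := by
    rw [show (3 / 2 : ℝ) = 1 / 2 + 1 by norm_num, Gamma_add_one (by norm_num), Gamma_one_half_eq]
  have hΓ₂ : Gamma (5 / 2) = 3 / 2 * (1 / 2 * √π) := by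
    rw [show (5 / 2 : ℝ) = 3 / 2 + 1 by norm_num, Gamma_add_one (by norm_num), hΓ₁]
  have hsπ : √π ≠ 0 := (Real.sqrt_pos.2 pi_pos).ne'
  have hlog_half : log (1 / 2 : ℝ) = -log 2 := by rw [one_div, log_inv]
  have hlog₁ : log (Gamma (3 / 2)) = log π / 2 - log 2 := by
    rw [hΓ₁, log_mul (by norm_num) hsπ, log_sqrt pi_pos.le, hlog_half]; ring
  have hlog₂ : log (Gamma (5 / 2)) = log π / 2 - 2 * log 2 + log 3 := by
    rw [hΓ₂, log_mul (by norm_num) (by positivity), log_mul (by norm_num) hsπ,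
      log_sqrt pi_pos.le, hlog_half, log_div (by norm_num) (by norm_num)]; ring
  have hconv := convexOn_log_Gamma.2 (show (3 / 2 : ℝ) ∈ Set.Ioi 0 by norm_num)
    (show (5 / 2 : ℝ) ∈ Set.Ioi 0 by norm_num)
    (show 0 ≤ 5 / 2 - z by linarith) (show 0 ≤ z - 3 / 2 by linarith) (by ring)
  have hcomb : (5 / 2 - z) • (3 / 2 : ℝ) + (z - 3 / 2) • (5 / 2 : ℝ) = z := by
    simp only [smul_eq_mul]; ring
  rw [hcomb] at hconv
  simp only [Function.comp_apply, smul_eq_mul, hlog₁, hlog₂] at hconv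
  have hlogz : log 2 + 1 - 2 / z ≤ log z := by
    have h := one_sub_inv_le_log_of_pos (show 0 < z / 2 by positivity)
    rw [log_div hz0.ne' two_ne_zero, inv_div] at h
    linarith
  have hmul := mul_le_mul_of_nonneg_left hlogz (show 0 ≤ z - 1 / 2 by linarith)
  have hinv : 1 - z / 4 ≤ 1 / z := by
    rw [le_div_iff₀ hz0]; nlinarith [sq_nonneg (z - 2)]
  have hexp : (z - 1 / 2) * (log 2 + 1 - 2 / z) = (z - 1 / 2) * (log 2 + 1) - 2 + 1 / z := by
    field_simp; ring
  have hlog2 := log_two_gt_d9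
  have hlog3 : log 3 < 1.14 := by
    have h : log 3 = 2 * log 2 + log (3 / 4) := by
      rw [log_div (by norm_num) (by norm_num), show (4 : ℝ) = 2 ^ 2 by norm_num, log_pow]
      push_cast; ring
    have h' : log (3 / 4 : ℝ) ≤ 3 / 4 - 1 := log_le_sub_one_of_pos (by norm_num)
    have := log_two_lt_d9
    linarith
  nlinarith [mul_nonneg (show 0 ≤ z - 3 / 2 by linarith)
      (show 0 ≤ 4 * log 2 - 1.63 - log 3 by linarith),
    mul_nonneg (show 0 ≤ 5 / 2 - z by linarith) (show 0 ≤ 2 * log 2 - 1.38 by linarith)]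

/-- A Stirling-type upper bound for the Gamma function: `Γ(z) < √π (z / e) ^ (z - 1 / 2)`. -/
lemma log_Gamma_lt {z : ℝ} (hz : 3 / 2 ≤ z) :
    log (Gamma z) < log π / 2 + (z - 1 / 2) * (log z - 1) := by
  suffices H : ∀ n : ℕ, ∀ w : ℝ, 3 / 2 ≤ w → w ≤ 5 / 2 + n →
      log (Gamma w) < log π / 2 + (w - 1 / 2) * (log w - 1) by
    obtain ⟨n, hn⟩ := exists_nat_ge z
    exact H n z hz (by linarith)
  intro n
  induction n with
  | zero => exact fun w h1 h2 ↦ log_Gamma_lt_of_mem_Icc ⟨h1, by simpa using h2⟩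
  | succ n ih =>
    intro w h1 h2
    rcases le_total w (5 / 2) with h | h
    · exact log_Gamma_lt_of_mem_Icc ⟨h1, h⟩
    push_cast at h2
    obtain ⟨v, rfl⟩ : ∃ v, w = v + 1 := ⟨w - 1, by ring⟩
    have hv : 0 < v := by linarith
    have hv' := ih v (by linarith) (by linarith)
    rw [Gamma_add_one hv.ne', log_mul hv.ne' (Gamma_pos_of_pos hv).ne']
    have hlog : 2 / (2 * v + 1) ≤ log (v + 1) - log v := by
      have := le_log_one_add_of_nonneg (inv_nonneg.2 hv.le)
      rw [show 1 + v⁻¹ = (v + 1) / v by field_simp, log_div (by positivity) hv.ne'] at this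
      convert this using 1
      field_simp
      ring
    have := mul_le_mul_of_nonneg_left hlog (show 0 ≤ v + 1 / 2 by positivity)
    have h1 : (v + 1 / 2) * (2 / (2 * v + 1)) = 1 := by field_simp
    linarith

lemma integral_abs_rpow_gaussianReal_lt {a : ℝ} (ha : 2 ≤ a) :
    ∫ t, |t| ^ a ∂(gaussianReal 0 1) < ((a + 1) / exp 1) ^ (a / 2) := by
  have hI : ∫ t, |t| ^ a ∂(gaussianReal 0 1) = 2 ^ (a / 2) * Gamma ((a + 1) / 2) / √π := by
    rw [integral_gaussianReal_eq_integral_smul one_ne_zero]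
    have h : ∀ t : ℝ, gaussianPDFReal 0 1 t • |t| ^ a
        = (fun s : ℝ ↦ (√(2 * π))⁻¹ * (s ^ a * exp (-(1 / 2) * s ^ (2 : ℝ)))) |t| := by
      intro t
      simp only [gaussianPDFReal, smul_eq_mul, rpow_two, sq_abs, NNReal.coe_one, mul_one, sub_zero]
      ring_nf
    rw [integral_congr_ae (.of_forall h),
      integral_comp_abs (f := fun s : ℝ ↦ (√(2 * π))⁻¹ * (s ^ a * exp (-(1 / 2) * s ^ (2 : ℝ)))),
      integral_const_mul,
      integral_rpow_mul_exp_neg_mul_rpow two_pos (by linarith) (by norm_num)]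
    have h2 : (1 / 2 : ℝ) ^ (-(a + 1) / 2) = 2 ^ (a / 2) * √2 := by
      rw [one_div, inv_rpow zero_le_two, ← rpow_neg zero_le_two, sqrt_eq_rpow,
        ← rpow_add two_pos]
      ring_nf
    rw [h2, sqrt_mul zero_le_two]
    have : √2 ≠ 0 := by positivity
    have : √π ≠ 0 := by positivity
    field_simp
  have hΓ : 0 < Gamma ((a + 1) / 2) := Gamma_pos_of_pos (by linarith)
  have key := log_Gamma_lt (z := (a + 1) / 2) (by linarith)
  have ha1 : 0 < a + 1 := by linarith
  rw [hI, ← log_lt_log_iff (by positivity) (by positivity), log_div (by positivity) (by positivity),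
    log_mul (by positivity) hΓ.ne', log_rpow two_pos, log_rpow (by positivity), log_sqrt pi_pos.le,
    log_div ha1.ne' (exp_ne_zero 1), log_exp]
  rw [log_div ha1.ne' two_ne_zero] at key
  linarith

section InnerMoments

variable {E : Type*} [NormedAddCommGroup E] [InnerProductSpace ℝ E] [FiniteDimensional ℝ E]
  [MeasurableSpace E] [BorelSpace E]

lemma map_inner_stdGaussian {x : E} (hx : ‖x‖ = 1) :
    (stdGaussian E).map (fun z ↦ ⟪x, z⟫) = gaussianReal 0 1 := by
  have h := IsGaussian.map_eq_gaussianReal (μ := stdGaussian E) (innerSL ℝ x)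
  rw [integral_strongDual_stdGaussian, variance_dual_stdGaussian, innerSL_apply_norm, hx] at h
  simpa using h

lemma integral_norm_sq_stdGaussian :
    ∫ z, ‖z‖ ^ 2 ∂(stdGaussian E) = Module.finrank ℝ E := by
  set b := stdOrthonormalBasis ℝ E
  have hint : ∀ i, ∫ z, ⟪b i, z⟫ ^ 2 ∂(stdGaussian E) = 1 := by
    intro i
    have h := integral_map (μ := stdGaussian E) (φ := fun z ↦ ⟪b i, z⟫) (f := fun t : ℝ ↦ t ^ 2)
      (by fun_prop) (by fun_prop)
    rw [← h, map_inner_stdGaussian (b.norm_eq_one i)]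
    have hv := variance_id_gaussianReal (μ := 0) (v := 1)
    rw [variance_eq_integral (by fun_prop)] at hv
    simpa using hv
  simp_rw [← b.sum_sq_inner_right]
  rw [integral_finsetSum]
  · simp [hint]
  · intro i _
    exact (IsGaussian.memLp_dual (stdGaussian E) (innerSL ℝ (b i)) 2 (by simp)).integrable_sq

lemma integrable_norm_rpow_stdGaussian {a : ℝ} (ha : 0 < a) :
    Integrable (fun z ↦ ‖z‖ ^ a) (stdGaussian E) := by
  have h := (IsGaussian.memLp_id (stdGaussian E) (ENNReal.ofReal a)
    ENNReal.ofReal_ne_top).integrable_norm_rpow (by simpa) ENNReal.ofReal_ne_top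
  simpa [ENNReal.toReal_ofReal ha.le] using h

lemma finrank_rpow_le_integral_norm_rpow_stdGaussian {a : ℝ} (ha : 2 ≤ a) :
    (Module.finrank ℝ E : ℝ) ^ (a / 2) ≤ ∫ z, ‖z‖ ^ a ∂(stdGaussian E) := by
  have hpow : ∀ z : E, (‖z‖ ^ 2) ^ (a / 2) = ‖z‖ ^ a := fun z ↦ by
    rw [← rpow_two, ← rpow_mul (norm_nonneg z)]; ring_nf
  have h := (convexOn_rpow (show 1 ≤ a / 2 by linarith)).map_integral_le
    (μ := stdGaussian E) (f := fun z ↦ ‖z‖ ^ 2)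
    (continuousOn_id.rpow_const fun _ _ ↦ Or.inr (by linarith)) isClosed_Ici
    (.of_forall fun z ↦ sq_nonneg ‖z‖)
    (IsGaussian.memLp_id (stdGaussian E) 2 (by simp)).integrable_norm_pow'
    (by simpa [Function.comp_def, hpow] using
      integrable_norm_rpow_stdGaussian (E := E) (show 0 < a by linarith))
  simpa only [integral_norm_sq_stdGaussian, hpow] using h

variable {σ : Measure E}

lemma integral_abs_inner_rpow_eq_of_norm_eq (hσ : ∀ g : E ≃ₗᵢ[ℝ] E, σ.map g = σ) {v w : E}
    (h : ‖v‖ = ‖w‖) (a : ℝ) :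
    ∫ x, |⟪x, v⟫| ^ a ∂σ = ∫ x, |⟪x, w⟫| ^ a ∂σ := by
  set g : E ≃ₗᵢ[ℝ] E := (ℝ ∙ (v - w))ᗮ.reflection
  have hg : g v = w := Submodule.reflection_sub h
  conv_rhs => rw [← hσ g]
  rw [integral_map (by fun_prop) (Measurable.aestronglyMeasurable (by fun_prop))]
  simp_rw [← hg, g.inner_map_map]

lemma integral_abs_inner_rpow_eq_mul (hσ : ∀ g : E ≃ₗᵢ[ℝ] E, σ.map g = σ) {v : E}
    (hv : v ≠ 0) (z : E) (a : ℝ) :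
    ∫ x, |⟪x, z⟫| ^ a ∂σ = (‖z‖ / ‖v‖) ^ a * ∫ x, |⟪x, v⟫| ^ a ∂σ := by
  have hv' : ‖v‖ ≠ 0 := norm_ne_zero_iff.2 hv
  have hnn : 0 ≤ ‖z‖ / ‖v‖ := by positivity
  rw [integral_abs_inner_rpow_eq_of_norm_eq hσ (w := (‖z‖ / ‖v‖) • v)
    (by rw [norm_smul, norm_of_nonneg hnn]; field_simp), ← integral_const_mul]
  congr with x
  rw [inner_smul_right, abs_mul, abs_of_nonneg hnn, mul_rpow hnn (abs_nonneg _)]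

lemma integral_abs_inner_rpow_le_gaussianReal [IsProbabilityMeasure σ]
    (hσ : ∀ g : E ≃ₗᵢ[ℝ] E, σ.map g = σ) (hsph : ∀ᵐ x ∂σ, ‖x‖ = 1) {v : E} (hv0 : v ≠ 0)
    (hv : ‖v‖ ^ 2 = Module.finrank ℝ E) {a : ℝ} (ha : 2 ≤ a) :
    ∫ x, |⟪x, v⟫| ^ a ∂σ ≤ ∫ t, |t| ^ a ∂(gaussianReal 0 1) := by
  have ha0 : 0 < a := by linarith
  have hv' : 0 < ‖v‖ := norm_pos_iff.2 hv0
  have hF : Integrable (Function.uncurry fun x z : E ↦ |⟪x, z⟫| ^ a)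
      (σ.prod (stdGaussian E)) := by
    refine ((integrable_norm_rpow_stdGaussian ha0).comp_snd σ).mono'
      (Measurable.aestronglyMeasurable (by unfold Function.uncurry; fun_prop)) ?_
    filter_upwards [Measure.quasiMeasurePreserving_fst.ae hsph] with p hp
    rw [Function.uncurry, norm_of_nonneg (by positivity)]
    gcongr
    simpa [hp] using abs_real_inner_le_norm p.1 p.2
  have hswap := integral_integral_swap hF
  have hleft : ∫ x, ∫ z, |⟪x, z⟫| ^ a ∂(stdGaussian E) ∂σ
      = ∫ t, |t| ^ a ∂(gaussianReal 0 1) := by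
    have : ∀ᵐ x ∂σ, ∫ z, |⟪x, z⟫| ^ a ∂(stdGaussian E) = ∫ t, |t| ^ a ∂(gaussianReal 0 1) := by
      filter_upwards [hsph] with x hx
      rw [← map_inner_stdGaussian hx, integral_map (by fun_prop)
        (Measurable.aestronglyMeasurable (by fun_prop))]
    rw [integral_congr_ae this, integral_const, probReal_univ, one_smul]
  rw [hleft] at hswap
  rw [hswap, integral_congr_ae (.of_forall fun z ↦ integral_abs_inner_rpow_eq_mul hσ hv0 z a),
    integral_mul_const]
  refine le_mul_of_one_le_left (integral_nonneg fun x ↦ by positivity) ?_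
  simp_rw [div_rpow (norm_nonneg _) (norm_nonneg _)]
  rw [integral_div, one_le_div (by positivity)]
  refine le_trans (le_of_eq ?_) (finrank_rpow_le_integral_norm_rpow_stdGaussian ha)
  rw [← hv, ← rpow_two, ← rpow_mul (norm_nonneg v)]
  ring_nf

end InnerMoments

lemma integral_rpow_one_div_le {Ω : Type*} [MeasurableSpace Ω] {ν : Measure Ω}
    [IsProbabilityMeasure ν] {a C : ℝ} (ha : 1 ≤ a) {F : Ω → ℝ} (hF : Measurable F)
    (hF0 : ∀ x, 0 ≤ F x) (hFC : ∀ᵐ x ∂ν, F x ≤ C) :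
    ∫ x, F x ^ (1 / a) ∂ν ≤ (∫ x, F x ∂ν) ^ (1 / a) := by
  have h0 : 0 ≤ 1 / a := by positivity
  refine (concaveOn_rpow h0 ?_).le_map_integral
    (continuousOn_id.rpow_const fun _ _ ↦ Or.inr h0) isClosed_Ici (.of_forall hF0) ?_ ?_
  · rw [div_le_one (by linarith)]; exact ha
  · refine .of_bound hF.aestronglyMeasurable C ?_
    filter_upwards [hFC] with x hx
    rwa [norm_of_nonneg (hF0 x)]
  · refine .of_bound (hF.pow_const _).aestronglyMeasurable (C ^ (1 / a)) ?_
    filter_upwards [hFC] with x hx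
    rw [Function.comp_apply, norm_of_nonneg (rpow_nonneg (hF0 x) _)]
    exact rpow_le_rpow (hF0 x) hx h0

theorem stmt_5
    {M : Type*} [MeasurableSpace M] (μ : Measure M) [IsProbabilityMeasure μ]
    (d : ℕ) (hd : 1 ≤ d)
    (e : Fin (d + 1) → M → ℝ)
    (hmeas : ∀ i, Measurable (e i))
    (horth : ∀ i j, ∫ p, e i p * e j p ∂μ = if i = j then 1 else 0)
    (hdiag : ∀ p, ∑ i, (e i p) ^ 2 = (d : ℝ) + 1)
    (σ : Measure (EuclideanSpace ℝ (Fin (d + 1)))) [IsProbabilityMeasure σ]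
    (hσsph : σ (Metric.sphere (0 : EuclideanSpace ℝ (Fin (d + 1))) 1) = 1)
    (hσinv : ∀ g : EuclideanSpace ℝ (Fin (d + 1)) ≃ₗᵢ[ℝ] EuclideanSpace ℝ (Fin (d + 1)),
      σ.map g = σ)
    (a : ℝ) (ha : 2 ≤ a) :
    ∫ x, (∫ p, |∑ i, x i * e i p| ^ a ∂μ) ^ (1 / a) ∂σ
      < Real.sqrt ((a + 1) / Real.exp 1) := by
  have ha0 : 0 < a := by linarith
  have hsph : ∀ᵐ x ∂σ, ‖x‖ = 1 := by
    have h := (prob_compl_eq_zero_iff Metric.isClosed_sphere.measurableSet).2 hσsph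
    filter_upwards [compl_mem_ae_iff.2 h] with x hx
    simpa using hx
  let v : M → EuclideanSpace ℝ (Fin (d + 1)) := fun p ↦ WithLp.toLp 2 fun i ↦ e i p
  have hinner : ∀ x p, ∑ i, x i * e i p = ⟪x, v p⟫ := fun x p ↦ by
    simp [v, PiLp.inner_apply, mul_comm]
  have hnorm : ∀ p, ‖v p‖ ^ 2 = (d : ℝ) + 1 := fun p ↦ by
    rw [EuclideanSpace.real_norm_sq_eq, ← hdiag p]
  have hnorm' : ∀ p, ‖v p‖ = √((d : ℝ) + 1) := fun p ↦ by
    rw [← hnorm p, sqrt_sq (norm_nonneg _)]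
  have hv0 : ∀ p, v p ≠ 0 := fun p hp ↦ by
    have := hnorm p
    rw [hp, norm_zero] at this
    have hd0 : (0 : ℝ) ≤ d := Nat.cast_nonneg d
    linarith
  have hvmeas : Measurable v := by fun_prop
  have hFmeas : Measurable
      (Function.uncurry fun (x : EuclideanSpace ℝ (Fin (d + 1))) p ↦ |⟪x, v p⟫| ^ a) := by
    unfold Function.uncurry; fun_prop
  have hbound : ∀ x p, ‖x‖ = 1 → |⟪x, v p⟫| ^ a ≤ √((d : ℝ) + 1) ^ a := fun x p hx ↦ by
    gcongr
    simpa [hx, hnorm' p] using abs_real_inner_le_norm x (v p)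
  simp_rw [hinner]
  have hjensen := integral_rpow_one_div_le (ν := σ) (a := a) (by linarith)
    (F := fun x ↦ ∫ p, |⟪x, v p⟫| ^ a ∂μ)
    hFmeas.stronglyMeasurable.integral_prod_right.measurable
    (fun x ↦ integral_nonneg fun p ↦ by positivity) (C := √((d : ℝ) + 1) ^ a) (by
      filter_upwards [hsph] with x hx
      refine (integral_mono_of_nonneg (.of_forall fun p ↦ by positivity) (integrable_const _)
        (.of_forall fun p ↦ hbound x p hx)).trans (by simp))
  refine hjensen.trans_lt ?_
  have hint : Integrable
      (Function.uncurry fun (x : EuclideanSpace ℝ (Fin (d + 1))) p ↦ |⟪x, v p⟫| ^ a)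
      (σ.prod μ) := by
    refine .of_bound hFmeas.aestronglyMeasurable (√((d : ℝ) + 1) ^ a) ?_
    filter_upwards [Measure.quasiMeasurePreserving_fst.ae hsph] with q hq
    rw [Function.uncurry, norm_of_nonneg (by positivity)]
    exact hbound _ _ hq
  have hle : ∫ x, ∫ p, |⟪x, v p⟫| ^ a ∂μ ∂σ ≤ ∫ t, |t| ^ a ∂(gaussianReal 0 1) := by
    rw [integral_integral_swap hint]
    refine (integral_mono_of_nonneg
      (.of_forall fun p ↦ integral_nonneg fun x ↦ by positivity) (integrable_const _)
      (.of_forall fun p ↦ integral_abs_inner_rpow_le_gaussianReal hσinv hsph (hv0 p)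
        (by simp [hnorm p]) ha)).trans (by simp)
  calc (∫ x, ∫ p, |⟪x, v p⟫| ^ a ∂μ ∂σ) ^ (1 / a)
      < (((a + 1) / exp 1) ^ (a / 2)) ^ (1 / a) :=
        rpow_lt_rpow (integral_nonneg fun x ↦ integral_nonneg fun p ↦ by positivity)
          (hle.trans_lt (integral_abs_rpow_gaussianReal_lt ha)) (by positivity)
    _ = √((a + 1) / exp 1) := by
        rw [← rpow_mul (by positivity), sqrt_eq_rpow]
        congr 1
        field_simp
end

section
/- Fix a real number a ≥ 1. For each n ∈ ℕ let (M_n, μ_n) be a probability space, d_n ≥ 1, and e^n_0, …, e^n_{d_n} : M_n → ℝ measurable functions forming an orthonormal family in L²(μ_n) and satisfying ∑_{i=0}^{d_n} e^n_i(p)² = d_n + 1 for every p ∈ M_n; let σ_n be the rotation-invariant probability measure on the unit sphere S^{d_n} of ℝ^{d_n+1} and u^n_x = ∑_i x_i e^n_i for x ∈ S^{d_n}. If d_n → ∞ as n → ∞, then limsup_{n→∞} ∫_{S^{d_n}} (∫_{M_n} |u^n_x(p)|^a dμ_n(p))^{1/a} dσ_n(x) ≤ √2 · π^{−1/(2a)}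 · Γ((a+1)/2)^{1/a}, and moreover √2 · π^{−1/(2a)} · Γ((a+1)/2)^{1/a} < √((a+1)/e). -/
open MeasureTheory Real Filter

open ProbabilityTheory
open scoped RealInnerProductSpace ENNReal

/-- Jensen's inequality for the power function. -/
lemma rpow_lintegral_le_lintegral_rpow {α : Type*} [MeasurableSpace α] (ν : Measure α)
    [IsProbabilityMeasure ν] {f : α → ℝ≥0∞} (hf : AEMeasurable f ν) {a : ℝ} (ha : 1 ≤ a) :
    (∫⁻ x, f x ∂ν) ^ a ≤ ∫⁻ x, f x ^ a ∂ν := by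
  have h := eLpNorm'_le_eLpNorm'_of_exponent_le (μ := ν) (f := f) one_pos ha hf.aestronglyMeasurable
  simp only [eLpNorm', enorm_eq_self, ENNReal.rpow_one, one_div, inv_one] at h
  calc _ ≤ ((∫⁻ x, f x ^ a ∂ν) ^ a⁻¹) ^ a := by gcongr
    _ = _ := ENNReal.rpow_inv_rpow (by positivity) _

lemma integral_abs_rpow_gaussianReal {a : ℝ} (ha : -1 < a) :
    ∫ t, |t| ^ a ∂(gaussianReal 0 1) = 2 ^ (a / 2) * Gamma ((a + 1) / 2) / √π := by
  rw [integral_gaussianReal_eq_integral_smul one_ne_zero]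
  have h := integral_comp_abs (f := fun t => gaussianPDFReal 0 1 t * t ^ a)
  simp only [smul_eq_mul]
  have h2 : ∀ t : ℝ, gaussianPDFReal 0 1 |t| = gaussianPDFReal 0 1 t := by
    intro t; simp [gaussianPDFReal]
  simp only [h2] at h
  rw [h]
  have h3 := integral_rpow_mul_exp_neg_mul_rpow (p := 2) (q := a) (b := 1/2) two_pos ha (by norm_num)
  have h4 : ∫ t in Set.Ioi (0:ℝ), gaussianPDFReal 0 1 t * t ^ a =
      (√(2 * π))⁻¹ * ∫ t in Set.Ioi (0:ℝ), t ^ a * exp (-(1/2) * t ^ (2:ℝ)) := by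
    rw [← integral_const_mul]
    congr 1 with t
    simp only [gaussianPDFReal, rpow_two, NNReal.coe_one, mul_one, sub_zero]
    ring_nf
  rw [h4, h3, one_div, inv_rpow zero_le_two, neg_div, rpow_neg zero_le_two, inv_inv,
    sqrt_mul zero_le_two, add_div, rpow_add two_pos, ← sqrt_eq_rpow]
  field_simp

lemma map_inner_stdGaussian_s6 {E : Type*} [NormedAddCommGroup E] [InnerProductSpace ℝ E]
    [FiniteDimensional ℝ E] [MeasurableSpace E] [BorelSpace E] {x : E} (hx : ‖x‖ = 1) :
    (stdGaussian E).map (fun y => ⟪x, y⟫) = gaussianReal 0 1 := by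
  have h := IsGaussian.map_eq_gaussianReal (μ := stdGaussian E) (innerSL ℝ x)
  rw [variance_dual_stdGaussian, integral_strongDual_stdGaussian, innerSL_apply_norm, hx] at h
  simpa using h

/-- The polynomial lower bound `√N (3 z - z ^ 2) / 2 ≤ r` at `z = r ^ 2 / N`. -/
lemma sqrt_mul_sub_le {N r : ℝ} (hN : 0 < N) (hr : 0 ≤ r) :
    √N * (3 * (r ^ 2 / N) - (r ^ 2) ^ 2 / N ^ 2) / 2 ≤ r := by
  obtain ⟨s, hs, rfl⟩ : ∃ s, 0 < s ∧ s ^ 2 = N := ⟨√N, sqrt_pos.2 hN, sq_sqrt hN.le⟩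
  obtain ⟨t, rfl⟩ : ∃ t, r = s * t := ⟨r / s, by field_simp⟩
  have ht : 0 ≤ t := by by_contra! h; nlinarith
  rw [sqrt_sq hs.le]
  field_simp
  nlinarith [mul_nonneg ht (mul_nonneg (sq_nonneg (t - 1)) (by linarith : 0 ≤ t + 2))]

/-- The deviation of `log Γ` from the main terms of Stirling's formula. -/
noncomputable def stirlingError (s : ℝ) : ℝ := log (Gamma s) - (s - 1 / 2) * log s + s

lemma stirlingError_sub_add_one {s : ℝ} (hs : 0 < s) :
    stirlingError s - stirlingError (s + 1) = (s + 1 / 2) * (log (s + 1) - log s) - 1 := by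
  rw [stirlingError, stirlingError, Gamma_add_one hs.ne',
    log_mul hs.ne' (Gamma_pos_of_pos hs).ne']
  ring

lemma log_add_one_sub_log_bounds {s : ℝ} (hs : 0 < s) :
    1 / (s + 1 / 2) ≤ log (s + 1) - log s ∧
      log (s + 1) - log s ≤ (s + 1 / 2) / (s * (s + 1)) := by
  have hs1 : 0 < s + 1 := by linarith
  rw [← log_div hs1.ne' hs.ne']
  constructor
  · have h := le_log_one_add_of_nonneg (x := 1 / s) (by positivity)
    convert h using 1
    · field_simp
      ring
    · congr 1
      field_simp
  · have h1 : 0 ≤ log ((s + 1) / s) := log_nonneg (by rw [le_div_iff₀ hs]; linarith)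
    have h := self_le_sinh_iff.2 h1
    rw [sinh_eq, exp_neg, exp_log (by positivity)] at h
    convert h using 1
    field_simp
    ring

lemma antitoneOn_stirlingError_sub_add_one :
    AntitoneOn (fun s : ℝ => (s + 1 / 2) * (log (s + 1) - log s) - 1) (Set.Ioi 0) := by
  have hd : ∀ s ∈ Set.Ioi (0 : ℝ),
      HasDerivAt (fun s : ℝ => (s + 1 / 2) * (log (s + 1) - log s) - 1)
        (1 * (log (s + 1) - log s) + (s + 1 / 2) * (1 / (s + 1) - 1 / s)) s := by
    intro s (hs : 0 < s)
    have h1 : HasDerivAt (fun s : ℝ => log (s + 1)) (1 / (s + 1)) s :=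
      ((hasDerivAt_id s).add_const 1).log (by simp; linarith)
    have h2 : HasDerivAt (fun s : ℝ => log s) (1 / s) s := by
      simpa using hasDerivAt_log hs.ne'
    exact (((hasDerivAt_id s).add_const (1 / 2)).mul (h1.sub h2)).sub_const 1
  refine antitoneOn_of_deriv_nonpos (convex_Ioi 0)
    (fun s hs => (hd s hs).continuousAt.continuousWithinAt) ?_ ?_
  · rw [interior_Ioi]
    exact fun s hs => (hd s hs).differentiableAt.differentiableWithinAt
  · rw [interior_Ioi]
    intro s hs
    rw [(hd s hs).deriv]
    have hs : 0 < s := hs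
    have h := (log_add_one_sub_log_bounds hs).2
    have : (s + 1 / 2) * (1 / (s + 1) - 1 / s) = -((s + 1 / 2) / (s * (s + 1))) := by
      field_simp
      ring
    linarith

lemma stirlingError_sub_le_add_nat {s t : ℝ} (ht : 0 < t) (hts : t ≤ s) (n : ℕ) :
    stirlingError s - stirlingError t ≤ stirlingError (s + n) - stirlingError (t + n) := by
  induction n with
  | zero => simp
  | succ n ih =>
    have hn : (0 : ℝ) ≤ n := n.cast_nonneg
    have h := antitoneOn_stirlingError_sub_add_one (a := t + n) (b := s + n)
      (show 0 < t + n by positivity) (show 0 < s + n by linarith) (by linarith)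
    simp only [← stirlingError_sub_add_one (show 0 < t + n by positivity),
      ← stirlingError_sub_add_one (show 0 < s + n by linarith)] at h
    push_cast
    rw [← add_assoc, ← add_assoc]
    linarith

lemma stirlingError_natCast_le_one {n : ℕ} (hn : 1 ≤ n) : stirlingError n ≤ 1 := by
  induction n, hn using Nat.le_induction with
  | base => simp [stirlingError]
  | succ n hn ih =>
    have hn : (0 : ℝ) < n := by exact_mod_cast hn
    have h := (log_add_one_sub_log_bounds hn).1
    rw [div_le_iff₀' (by positivity)] at h
    have := stirlingError_sub_add_one hn
    push_cast
    linarith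

lemma stirlingError_nat_add_sub_le {n : ℕ} (hn : n ≠ 0) {x : ℝ} (hx : 0 < x) (hx1 : x ≤ 1) :
    stirlingError (n + x) - stirlingError n ≤ 1 / n := by
  have hn0 : (0 : ℝ) < n := by positivity
  have h := BohrMollerup.f_add_nat_le (f := log ∘ Gamma) convexOn_log_Gamma
    (fun {y} hy => by
      simp [Gamma_add_one hy.ne', log_mul hy.ne' (Gamma_pos_of_pos hy).ne', add_comm]) hn hx hx1
  simp only [Function.comp] at h
  have hlog : x / (n + x) ≤ log (n + x) - log n := by
    have := one_sub_inv_le_log_of_pos (show 0 < (n + x) / n by positivity)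
    rw [log_div (by positivity) hn0.ne'] at this
    convert this using 1
    field_simp
    ring
  have hn1 : (1 : ℝ) ≤ n := by exact_mod_cast Nat.one_le_iff_ne_zero.2 hn
  have h2 : (n + x - 1 / 2) * (x / (n + x)) ≤ (n + x - 1 / 2) * (log (n + x) - log n) :=
    mul_le_mul_of_nonneg_left hlog (by linarith)
  have h3 : x - (n + x - 1 / 2) * (x / (n + x)) ≤ 1 / n := by
    field_simp
    nlinarith
  simp only [stirlingError]
  linarith

lemma stirlingError_le_one {s : ℝ} (hs : 1 ≤ s) : stirlingError s ≤ 1 := by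
  obtain ⟨m, x, hm, hx, hx1, rfl⟩ : ∃ (m : ℕ) (x : ℝ), 1 ≤ m ∧ 0 ≤ x ∧ x ≤ 1 ∧ s = m + x :=
    ⟨⌊s⌋₊, s - ⌊s⌋₊, Nat.le_floor (by simpa using hs),
      sub_nonneg.2 (Nat.floor_le (by linarith)), by linarith [Nat.lt_floor_add_one s], by ring⟩
  rcases hx.eq_or_lt with rfl | hx
  · simpa using stirlingError_natCast_le_one hm
  have hm0 : (0 : ℝ) < m := by exact_mod_cast hm
  refine le_trans ?_ (stirlingError_natCast_le_one hm)
  have hlim : Tendsto (fun n : ℕ => 1 / ((m + n : ℕ) : ℝ)) atTop (nhds 0) :=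
    (tendsto_one_div_atTop_nhds_zero_nat (𝕜 := ℝ)).comp (tendsto_add_atTop_nat m |>.congr
      fun n => add_comm n m)
  rw [← sub_nonpos]
  refine ge_of_tendsto' hlim fun n => ?_
  refine (stirlingError_sub_le_add_nat hm0 (by linarith) n).trans ?_
  have := stirlingError_nat_add_sub_le (n := m + n) (by omega) hx hx1
  push_cast at this ⊢
  rwa [add_right_comm]

lemma Gamma_le_exp_mul_rpow {s : ℝ} (hs : 1 ≤ s) :
    Gamma s ≤ exp 1 * (s ^ (s - 1 / 2) * exp (-s)) := by
  have hs0 : 0 < s := by linarith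
  have h := stirlingError_le_one hs
  rw [stirlingError] at h
  rw [rpow_def_of_pos hs0, ← exp_add, ← exp_add, ← log_le_iff_le_exp (Gamma_pos_of_pos hs0)]
  linarith

lemma sqrt_two_mul_pi_rpow_mul_Gamma_rpow_eq {a : ℝ} (ha : 0 < a) :
    √2 * π ^ (-(1 / (2 * a))) * Gamma ((a + 1) / 2) ^ (1 / a) =
      (2 ^ (a / 2) * Gamma ((a + 1) / 2) / √π) ^ (1 / a) := by
  have hG := Gamma_pos_of_pos (show 0 < (a + 1) / 2 by positivity)
  rw [div_rpow (by positivity) (by positivity), mul_rpow (by positivity) hG.le,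
    ← rpow_mul zero_le_two, sqrt_eq_rpow, sqrt_eq_rpow, ← rpow_mul pi_pos.le, rpow_neg pi_pos.le]
  field_simp

lemma sqrt_two_mul_pi_rpow_mul_Gamma_rpow_lt {a : ℝ} (ha : 1 ≤ a) :
    √2 * π ^ (-(1 / (2 * a))) * Gamma ((a + 1) / 2) ^ (1 / a) < √((a + 1) / exp 1) := by
  have ha0 : 0 < a := by linarith
  rw [sqrt_two_mul_pi_rpow_mul_Gamma_rpow_eq ha0]
  obtain ⟨s, rfl⟩ : ∃ s, a = 2 * s - 1 := ⟨(a + 1) / 2, by ring⟩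
  have hs : 1 ≤ s := by linarith
  have hs0 : 0 < s := by linarith
  have hG := Gamma_pos_of_pos hs0
  rw [sub_add_cancel, mul_div_cancel_left₀ s two_ne_zero, one_div,
    rpow_inv_lt_iff_of_pos (by positivity) (by positivity) ha0,
    sqrt_eq_rpow (2 * s / exp 1),
    ← rpow_mul (by positivity),
    show 1 / 2 * (2 * s - 1) = s - 1 / 2 by ring, show (2 * s - 1) / 2 = s - 1 / 2 by ring,
    div_rpow (by positivity) (by positivity), mul_rpow zero_le_two hs0.le, ← exp_mul, one_mul,
    div_lt_iff₀ (by positivity), mul_div_assoc, mul_assoc]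
  gcongr
  refine (Gamma_le_exp_mul_rpow hs).trans_lt ?_
  have hpi : exp (1 / 2) < √π := by
    rw [exp_half]
    exact sqrt_lt_sqrt (by positivity) (by linarith [exp_one_lt_d9, pi_gt_three])
  calc exp 1 * (s ^ (s - 1 / 2) * exp (-s))
      = s ^ (s - 1 / 2) / exp (s - 1 / 2) * exp (1 / 2) := by
        rw [mul_left_comm, ← exp_add, div_mul_eq_mul_div, mul_div_assoc, ← exp_sub]
        ring_nf
    _ < _ := by gcongr

lemma integrable_pow_gaussianReal (n : ℕ) :
    Integrable (fun t : ℝ => t ^ n) (gaussianReal 0 1) := by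
  have := (memLp_id_gaussianReal (μ := 0) (v := 1) n).integrable_norm_pow'
  rw [← integrable_norm_iff (by fun_prop)]
  simpa using this

lemma integral_sq_gaussianReal : ∫ t, t ^ 2 ∂(gaussianReal 0 1) = 1 := by
  have h := integral_abs_rpow_gaussianReal (a := 2) (by norm_num)
  have hG : Gamma (3 / 2) = √π / 2 := by
    rw [show (3 / 2 : ℝ) = 1 / 2 + 1 by norm_num, Gamma_add_one (by norm_num), Gamma_one_half_eq]
    ring
  norm_num [hG] at h
  rw [h]
  field_simp

lemma integral_pow_four_gaussianReal : ∫ t, t ^ 4 ∂(gaussianReal 0 1) = 3 := by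
  have h := integral_abs_rpow_gaussianReal (a := 4) (by norm_num)
  have hG : Gamma (5 / 2) = 3 / 4 * √π := by
    rw [show (5 / 2 : ℝ) = 1 / 2 + 1 + 1 by norm_num, Gamma_add_one (by norm_num),
      Gamma_add_one (by norm_num), Gamma_one_half_eq]
    ring
  have h4 : ∀ t : ℝ, |t| ^ (4 : ℝ) = t ^ 4 := fun t => by
    rw [show (4 : ℝ) = (4 : ℕ) by norm_num, rpow_natCast, Even.pow_abs (by decide)]
  simp only [h4] at h
  rw [h, show (4 / 2 : ℝ) = (2 : ℕ) by norm_num, rpow_natCast,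
    show (4 + 1 : ℝ) / 2 = 5 / 2 by norm_num, hG]
  field_simp
  norm_num

section stdGaussian

variable {ι : Type*} [Fintype ι]

lemma integrable_norm_pow_stdGaussian (n : ℕ) :
    Integrable (fun y => ‖y‖ ^ n) (stdGaussian (EuclideanSpace ℝ ι)) :=
  (IsGaussian.memLp_id (stdGaussian (EuclideanSpace ℝ ι)) n (by simp)).integrable_norm_pow'

lemma memLp_sq_gaussianReal : MemLp (fun t : ℝ => t ^ 2) 2 (gaussianReal 0 1) := by
  rw [memLp_two_iff_integrable_sq (by fun_prop)]
  simpa only [← pow_mul] using integrable_pow_gaussianReal 4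

lemma integral_norm_sq_stdGaussian_s6 :
    ∫ y, ‖y‖ ^ 2 ∂(stdGaussian (EuclideanSpace ℝ ι)) = Fintype.card ι := by
  rw [← map_pi_eq_stdGaussian, integral_map (by fun_prop) (by fun_prop)]
  simp only [EuclideanSpace.real_norm_sq_eq]
  rw [integral_finsetSum _ fun i _ =>
    integrable_comp_eval (μ := fun _ : ι => gaussianReal 0 1) (i := i)
      (f := fun t : ℝ => t ^ 2) (integrable_pow_gaussianReal 2)]
  simp [integral_comp_eval (μ := fun _ : ι => gaussianReal 0 1) (f := fun t : ℝ => t ^ 2)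
    (integrable_pow_gaussianReal 2).aestronglyMeasurable, integral_sq_gaussianReal]

lemma integral_norm_sq_sq_stdGaussian :
    ∫ y, (‖y‖ ^ 2) ^ 2 ∂(stdGaussian (EuclideanSpace ℝ ι)) =
      (Fintype.card ι : ℝ) ^ 2 + 2 * Fintype.card ι := by
  have hm : MemLp (fun y : EuclideanSpace ℝ ι => ‖y‖ ^ 2) 2 (stdGaussian _) := by
    rw [memLp_two_iff_integrable_sq (by fun_prop)]
    simpa only [← pow_mul] using integrable_norm_pow_stdGaussian 4
  have hv : Var[fun y : EuclideanSpace ℝ ι => ‖y‖ ^ 2; stdGaussian _] = 2 * Fintype.card ι := by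
    have h := variance_sum_pi (μ := fun _ : ι => gaussianReal 0 1)
      (X := fun _ (t : ℝ) => t ^ 2) fun _ => memLp_sq_gaussianReal
    have h1 : Var[fun t : ℝ => t ^ 2; gaussianReal 0 1] = 2 := by
      rw [variance_eq_sub memLp_sq_gaussianReal]
      simp only [Pi.pow_apply, ← pow_mul, integral_sq_gaussianReal]
      norm_num [integral_pow_four_gaussianReal]
    rw [← map_pi_eq_stdGaussian, variance_map (by fun_prop) (by fun_prop)]
    simp only [h1, Finset.sum_const, Finset.card_univ, nsmul_eq_mul] at h
    rw [mul_comm, ← h]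
    congr 1 with x
    simp [EuclideanSpace.real_norm_sq_eq]
  rw [variance_eq_sub hm, integral_norm_sq_stdGaussian_s6] at hv
  simp only [Pi.pow_apply] at hv
  linarith

lemma le_integral_norm_stdGaussian [Nonempty ι] :
    (Fintype.card ι - 1 : ℝ) / √(Fintype.card ι) ≤ ∫ y, ‖y‖ ∂(stdGaussian (EuclideanSpace ℝ ι)) := by
  set N := (Fintype.card ι : ℝ) with hN
  have hN0 : 0 < N := by rw [hN]; exact_mod_cast Fintype.card_pos
  have i1 := integrable_norm_pow_stdGaussian (ι := ι) 2
  have i2 : Integrable (fun y => (‖y‖ ^ 2) ^ 2) (stdGaussian (EuclideanSpace ℝ ι)) := by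
    simpa only [← pow_mul] using integrable_norm_pow_stdGaussian 4
  have i3 := (i1.div_const N).const_mul 3
  have h := integral_mono (μ := stdGaussian (EuclideanSpace ℝ ι))
    (((i3.sub (i2.div_const (N ^ 2))).const_mul (√N)).div_const 2)
    (by simpa using integrable_norm_pow_stdGaussian (ι := ι) 1)
    fun y => sqrt_mul_sub_le hN0 (norm_nonneg y)
  refine le_trans (le_of_eq ?_) h
  simp only [Pi.sub_apply]
  rw [integral_div, integral_const_mul, integral_sub i3 (i2.div_const _), integral_const_mul,
    integral_div, integral_div, integral_norm_sq_stdGaussian_s6, integral_norm_sq_sq_stdGaussian, ← hN]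
  have := sq_sqrt hN0.le
  field_simp
  rw [this]
  ring

lemma le_lintegral_norm_rpow_stdGaussian [Nonempty ι] {a : ℝ} (ha : 1 ≤ a) :
    ENNReal.ofReal (((Fintype.card ι - 1 : ℝ) / √(Fintype.card ι)) ^ a) ≤
      ∫⁻ y, ENNReal.ofReal (‖y‖ ^ a) ∂(stdGaussian (EuclideanSpace ℝ ι)) := by
  have ha0 : 0 ≤ a := by linarith
  have h1 : (1 : ℝ) ≤ Fintype.card ι := by exact_mod_cast Fintype.card_pos
  simp only [← ENNReal.ofReal_rpow_of_nonneg (norm_nonneg _) ha0]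
  rw [← ENNReal.ofReal_rpow_of_nonneg (div_nonneg (by linarith) (sqrt_nonneg _)) ha0]
  refine le_trans ?_ (rpow_lintegral_le_lintegral_rpow _ (by fun_prop) ha)
  rw [← ofReal_integral_eq_lintegral_ofReal
    (by simpa using integrable_norm_pow_stdGaussian (ι := ι) 1) (ae_of_all _ fun y => norm_nonneg y)]
  gcongr
  exact le_integral_norm_stdGaussian

end stdGaussian

section sphere

variable {ι : Type*} [Fintype ι] {σ : Measure (EuclideanSpace ℝ ι)}

lemma lintegral_abs_inner_rpow_eq_of_norm_eq
    (hσ : ∀ g : EuclideanSpace ℝ ι ≃ₗᵢ[ℝ] EuclideanSpace ℝ ι, σ.map g = σ) (a : ℝ)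
    {v w : EuclideanSpace ℝ ι} (hvw : ‖v‖ = ‖w‖) :
    ∫⁻ x, ENNReal.ofReal (|⟪x, v⟫| ^ a) ∂σ = ∫⁻ x, ENNReal.ofReal (|⟪x, w⟫| ^ a) ∂σ := by
  obtain ⟨g, rfl⟩ : ∃ g : EuclideanSpace ℝ ι ≃ₗᵢ[ℝ] EuclideanSpace ℝ ι, g v = w :=
    ⟨_, Submodule.reflection_sub hvw⟩
  conv_rhs => rw [← hσ g]
  rw [lintegral_map (by fun_prop) (by fun_prop)]
  simp

lemma lintegral_abs_inner_rpow_eq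
    (hσ : ∀ g : EuclideanSpace ℝ ι ≃ₗᵢ[ℝ] EuclideanSpace ℝ ι, σ.map g = σ) (a : ℝ)
    {u : EuclideanSpace ℝ ι} (hu : ‖u‖ = 1) (v : EuclideanSpace ℝ ι) :
    ∫⁻ x, ENNReal.ofReal (|⟪x, v⟫| ^ a) ∂σ =
      ENNReal.ofReal (‖v‖ ^ a) * ∫⁻ x, ENNReal.ofReal (|⟪x, u⟫| ^ a) ∂σ := by
  rw [lintegral_abs_inner_rpow_eq_of_norm_eq hσ a (w := ‖v‖ • u) (by simp [norm_smul, hu]),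
    ← lintegral_const_mul _ (by fun_prop)]
  congr 1 with x
  rw [inner_smul_right, abs_mul, abs_norm, mul_rpow (norm_nonneg _) (abs_nonneg _),
    ENNReal.ofReal_mul (by positivity)]

lemma lintegral_norm_rpow_mul_lintegral_abs_inner_rpow [IsProbabilityMeasure σ]
    (hσ : ∀ g : EuclideanSpace ℝ ι ≃ₗᵢ[ℝ] EuclideanSpace ℝ ι, σ.map g = σ)
    (hsph : σ (Metric.sphere 0 1) = 1) (a : ℝ)
    {u : EuclideanSpace ℝ ι} (hu : ‖u‖ = 1) :
    (∫⁻ y, ENNReal.ofReal (‖y‖ ^ a) ∂(stdGaussian (EuclideanSpace ℝ ι))) *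
      ∫⁻ x, ENNReal.ofReal (|⟪x, u⟫| ^ a) ∂σ =
      ∫⁻ t, ENNReal.ofReal (|t| ^ a) ∂(gaussianReal 0 1) := by
  rw [← lintegral_mul_const _ (by fun_prop)]
  simp only [← lintegral_abs_inner_rpow_eq hσ a hu]
  rw [lintegral_lintegral_swap (by fun_prop)]
  have hae : ∀ᵐ x ∂σ, ‖x‖ = 1 := by
    have : ∀ᵐ x ∂σ, x ∈ Metric.sphere (0 : EuclideanSpace ℝ ι) 1 :=
      (mem_ae_iff_prob_eq_one Metric.isClosed_sphere.measurableSet).2 hsph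
    simpa using this
  rw [lintegral_congr_ae (g := fun _ => ∫⁻ t, ENNReal.ofReal (|t| ^ a) ∂(gaussianReal 0 1))]
  · simp
  · filter_upwards [hae] with x hx
    rw [← map_inner_stdGaussian_s6 hx, lintegral_map (by fun_prop) (by fun_prop)]

lemma lintegral_lintegral_abs_inner_rpow_le [IsProbabilityMeasure σ]
    (hσ : ∀ g : EuclideanSpace ℝ ι ≃ₗᵢ[ℝ] EuclideanSpace ℝ ι, σ.map g = σ)
    (hsph : σ (Metric.sphere 0 1) = 1) {a : ℝ} (ha : 1 ≤ a) (hι : 2 ≤ Fintype.card ι)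
    {M : Type*} [MeasurableSpace M] (μ : Measure M) [IsProbabilityMeasure μ]
    {v : M → EuclideanSpace ℝ ι} (hv : Measurable v) (hnorm : ∀ p, ‖v p‖ = √(Fintype.card ι)) :
    ∫⁻ x, ∫⁻ p, ENNReal.ofReal (|⟪x, v p⟫| ^ a) ∂μ ∂σ ≤
      ENNReal.ofReal (2 ^ (a / 2) * Gamma ((a + 1) / 2) / √π *
        ((Fintype.card ι : ℝ) / (Fintype.card ι - 1)) ^ a) := by
  classical
  have hne : Nonempty ι := Fintype.card_pos_iff.1 (by omega)
  have i := hne.some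
  have hN : (2 : ℝ) ≤ Fintype.card ι := by exact_mod_cast hι
  have hu : ‖EuclideanSpace.single i (1 : ℝ)‖ = 1 := by simp
  have hG : 0 < Gamma ((a + 1) / 2) := Gamma_pos_of_pos (by linarith)
  have hmom := lintegral_norm_rpow_mul_lintegral_abs_inner_rpow hσ hsph a hu
  have hint : Integrable (fun t : ℝ => |t| ^ a) (gaussianReal 0 1) :=
    .of_integral_ne_zero (by rw [integral_abs_rpow_gaussianReal (by linarith)]; positivity)
  rw [← ofReal_integral_eq_lintegral_ofReal hint (ae_of_all _ fun t => by positivity),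
    integral_abs_rpow_gaussianReal (by linarith)] at hmom
  have hle := le_lintegral_norm_rpow_stdGaussian (ι := ι) ha
  set N := (Fintype.card ι : ℝ)
  have hN1 : 0 < N - 1 := by linarith
  rw [lintegral_lintegral_swap (by fun_prop)]
  rw [lintegral_congr fun p => lintegral_abs_inner_rpow_eq hσ a hu (v p)]
  simp only [hnorm, lintegral_const, measure_univ, mul_one]
  have hsplit : √N ^ a = (N / (N - 1)) ^ a * ((N - 1) / √N) ^ a := by
    rw [← mul_rpow (by positivity) (by positivity)]
    congr 1
    field_simp
    rw [sq_sqrt (by linarith)]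
  rw [hsplit, ENNReal.ofReal_mul (by positivity), mul_assoc, mul_comm (_ / √π),
    ENNReal.ofReal_mul (by positivity), ← hmom]
  gcongr

lemma integral_rpow_integral_abs_inner_le [IsProbabilityMeasure σ]
    (hσ : ∀ g : EuclideanSpace ℝ ι ≃ₗᵢ[ℝ] EuclideanSpace ℝ ι, σ.map g = σ)
    (hsph : σ (Metric.sphere 0 1) = 1) {a : ℝ} (ha : 1 ≤ a) (hι : 2 ≤ Fintype.card ι)
    {M : Type*} [MeasurableSpace M] (μ : Measure M) [IsProbabilityMeasure μ]
    {v : M → EuclideanSpace ℝ ι} (hv : Measurable v) (hnorm : ∀ p, ‖v p‖ = √(Fintype.card ι)) :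
    ∫ x, (∫ p, |⟪x, v p⟫| ^ a ∂μ) ^ (1 / a) ∂σ ≤
      (2 ^ (a / 2) * Gamma ((a + 1) / 2) / √π) ^ (1 / a) *
        ((Fintype.card ι : ℝ) / (Fintype.card ι - 1)) := by
  have ha0 : 0 < a := by linarith
  have hN : (2 : ℝ) ≤ Fintype.card ι := by exact_mod_cast hι
  have hN1 : (0 : ℝ) < Fintype.card ι - 1 := by linarith
  have hG : 0 < Gamma ((a + 1) / 2) := Gamma_pos_of_pos (by linarith)
  have hF : ∀ x, 0 ≤ ∫ p, |⟪x, v p⟫| ^ a ∂μ := fun x => integral_nonneg fun p => by positivity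
  have hpt : ∀ x, ENNReal.ofReal ‖(∫ p, |⟪x, v p⟫| ^ a ∂μ) ^ (1 / a)‖ ≤
      (∫⁻ p, ENNReal.ofReal (|⟪x, v p⟫| ^ a) ∂μ) ^ (1 / a) := fun x => by
    rw [norm_of_nonneg (rpow_nonneg (hF x) _),
      ← ENNReal.ofReal_rpow_of_nonneg (hF x) (by positivity)]
    gcongr
    rw [integral_eq_lintegral_of_nonneg_ae (ae_of_all _ fun p => by positivity)
      (Measurable.aestronglyMeasurable (by fun_prop))]
    exact ENNReal.ofReal_toReal_le
  have hmeas : Measurable fun x => ∫⁻ p, ENNReal.ofReal (|⟪x, v p⟫| ^ a) ∂μ :=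
    Measurable.lintegral_prod_right' (f := fun z : EuclideanSpace ℝ ι × M =>
      ENNReal.ofReal (|⟪z.1, v z.2⟫| ^ a)) (by fun_prop)
  refine (le_norm_self _).trans ((norm_integral_le_lintegral_norm _).trans ?_)
  refine ENNReal.toReal_le_of_le_ofReal (by positivity) ((lintegral_mono hpt).trans ?_)
  have hJ := rpow_lintegral_le_lintegral_rpow σ (hmeas.pow_const (1 / a)).aemeasurable ha
  simp only [one_div, ENNReal.rpow_inv_rpow ha0.ne'] at hJ
  have h := hJ.trans (lintegral_lintegral_abs_inner_rpow_le hσ hsph ha hι μ hv hnorm)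
  rw [← ENNReal.le_rpow_inv_iff ha0, ENNReal.ofReal_rpow_of_nonneg (by positivity) (by positivity),
    mul_rpow (by positivity) (by positivity), rpow_rpow_inv (by positivity) ha0.ne'] at h
  simpa only [one_div] using h

end sphere

theorem stmt_6
    (a : ℝ) (ha : 1 ≤ a)
    (M : ℕ → Type*) [∀ n, MeasurableSpace (M n)]
    (μ : (n : ℕ) → Measure (M n)) [∀ n, IsProbabilityMeasure (μ n)]
    (d : ℕ → ℕ) (hd : ∀ n, 1 ≤ d n)
    (e : (n : ℕ) → Fin (d n + 1) → M n → ℝ)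
    (hmeas : ∀ n i, Measurable (e n i))
    (horth : ∀ n, ∀ i j : Fin (d n + 1),
      ∫ p, e n i p * e n j p ∂(μ n) = if i = j then 1 else 0)
    (hdiag : ∀ n, ∀ p : M n, ∑ i, (e n i p) ^ 2 = (d n : ℝ) + 1)
    (σ : (n : ℕ) → Measure (EuclideanSpace ℝ (Fin (d n + 1))))
    [∀ n, IsProbabilityMeasure (σ n)]
    (hσsph : ∀ n, σ n (Metric.sphere (0 : EuclideanSpace ℝ (Fin (d n + 1))) 1) = 1)
    (hσinv : ∀ n, ∀ g : EuclideanSpace ℝ (Fin (d n + 1)) ≃ₗᵢ[ℝ] EuclideanSpace ℝ (Fin (d n + 1)),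
      (σ n).map g = σ n)
    (hdtop : Filter.Tendsto d Filter.atTop Filter.atTop) :
    Filter.limsup (fun n =>
        ∫ x, (∫ p, |∑ i, x i * e n i p| ^ a ∂(μ n)) ^ (1 / a) ∂(σ n)) Filter.atTop
      ≤ Real.sqrt 2 * Real.pi ^ (-(1 / (2 * a))) * Real.Gamma ((a + 1) / 2) ^ (1 / a) ∧
    Real.sqrt 2 * Real.pi ^ (-(1 / (2 * a))) * Real.Gamma ((a + 1) / 2) ^ (1 / a)
      < Real.sqrt ((a + 1) / Real.exp 1) := by
  have ha0 : 0 < a := by linarith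
  refine ⟨?_, sqrt_two_mul_pi_rpow_mul_Gamma_rpow_lt ha⟩
  rw [sqrt_two_mul_pi_rpow_mul_Gamma_rpow_eq ha0]
  set K := (2 ^ (a / 2) * Gamma ((a + 1) / 2) / √π) ^ (1 / a)
  have hbound : ∀ n, ∫ x, (∫ p, |∑ i, x i * e n i p| ^ a ∂(μ n)) ^ (1 / a) ∂(σ n) ≤
      K * (1 + 1 / (d n : ℝ)) := fun n => by
    have hdn : (0 : ℝ) < d n := by exact_mod_cast hd n
    have h := integral_rpow_integral_abs_inner_le (hσinv n) (hσsph n) ha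
      (by simpa using hd n) (μ n) (v := fun p => WithLp.toLp 2 fun i => e n i p)
      (by fun_prop) (fun p => by simp [EuclideanSpace.norm_eq, hdiag n p])
    simp only [Fintype.card_fin, Nat.cast_add, Nat.cast_one, add_sub_cancel_right,
      PiLp.inner_apply, RCLike.inner_apply, conj_trivial, mul_comm (e n _ _)] at h
    rwa [add_div (d n : ℝ), div_self hdn.ne'] at h
  have hlim : Tendsto (fun n => K * (1 + 1 / (d n : ℝ))) atTop (nhds K) := by
    have h := (tendsto_one_div_atTop_nhds_zero_nat (𝕜 := ℝ)).comp hdtop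
    simpa using (h.const_add 1).const_mul K
  rw [← hlim.limsup_eq]
  refine limsup_le_limsup (Eventually.of_forall hbound) ?_ hlim.isBoundedUnder_le
  exact (isBoundedUnder_of ⟨0, fun n => integral_nonneg fun x =>
    rpow_nonneg (integral_nonneg fun p => by positivity) _⟩ :
    IsBoundedUnder (· ≥ ·) atTop _).isCoboundedUnder_le
end

section
/- Let (M, ρ) be a nonempty metric space with a Borel probability measure μ, and let b, r_0, m > 0 satisfy μ(B(p,r)) > b·r^m for every p ∈ M and every r ∈ (0, r_0), where B(p,r) is the open ball of radius r. Let u : M → ℝ be Lipschitz with constant κ ≥ 0, and let a ≥ 1. Then for every r ∈ (0, r_0): sup_{p∈M} |u(p)| ≤ b^{−1/a} · r^{−m/a} · (∫_M |u|^a dμ)^{1/a} + κ·r. -/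
open MeasureTheory Real

/-- A lower bound on a measurable set bounds the integral of a power from below. -/
lemma ofReal_rpow_mul_le_lintegral {M : Type*} [MeasurableSpace M] {μ : Measure M} {s : Set M}
    (hs : MeasurableSet s) {u : M → ℝ} {t a c : ℝ} (ht : 0 ≤ t) (ha : 0 ≤ a)
    (hc : ENNReal.ofReal c ≤ μ s) (htu : ∀ q ∈ s, t ≤ |u q|) :
    ENNReal.ofReal (t ^ a * c) ≤ ∫⁻ q, ENNReal.ofReal (|u q| ^ a) ∂μ :=
  calc ENNReal.ofReal (t ^ a * c)
      = ENNReal.ofReal (t ^ a) * ENNReal.ofReal c := ENNReal.ofReal_mul (by positivity)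
    _ ≤ ENNReal.ofReal (t ^ a) * μ s := by gcongr
    _ = ∫⁻ _ in s, ENNReal.ofReal (t ^ a) ∂μ := (setLIntegral_const _ _).symm
    _ ≤ ∫⁻ q in s, ENNReal.ofReal (|u q| ^ a) ∂μ :=
        setLIntegral_mono' hs fun q hq =>
          ENNReal.ofReal_le_ofReal (Real.rpow_le_rpow ht (htu q hq) ha)
    _ ≤ ∫⁻ q, ENNReal.ofReal (|u q| ^ a) ∂μ := setLIntegral_le_lintegral _ _

theorem stmt_8
    {M : Type*} [MetricSpace M] [Nonempty M] [MeasurableSpace M] [BorelSpace M]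
    (μ : Measure M) [IsProbabilityMeasure μ]
    (b r₀ m : ℝ) (hb : 0 < b) (hr₀ : 0 < r₀) (hm : 0 < m)
    (hball : ∀ p : M, ∀ r : ℝ, 0 < r → r < r₀ →
      ENNReal.ofReal (b * r ^ m) < μ (Metric.ball p r))
    (u : M → ℝ) (κ : ℝ) (hκ : 0 ≤ κ)
    (hLip : ∀ p q : M, |u p - u q| ≤ κ * dist p q)
    (a : ℝ) (ha : 1 ≤ a)
    (r : ℝ) (hr : 0 < r) (hrr₀ : r < r₀) :
    ∀ p : M, ENNReal.ofReal |u p|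
      ≤ ENNReal.ofReal (b ^ (-(1 : ℝ) / a) * r ^ (-(m / a))) *
          (∫⁻ q, ENNReal.ofReal (|u q| ^ a) ∂μ) ^ (1 / a) +
        ENNReal.ofReal (κ * r) := by
  intro p
  have ha0 : 0 < a := by linarith
  rcases le_or_gt (|u p| - κ * r) 0 with h | ht
  · exact (ENNReal.ofReal_le_ofReal (by linarith)).trans le_add_self
  set t := |u p| - κ * r with ht_def
  have hlow : ∀ q ∈ Metric.ball p r, t ≤ |u q| := fun q hq => by
    have hdist : κ * dist p q ≤ κ * r :=
      mul_le_mul_of_nonneg_left (Metric.mem_ball'.1 hq).le hκ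
    linarith [hLip p q, abs_sub_abs_le_abs_sub (u p) (u q)]
  have hI := ofReal_rpow_mul_le_lintegral measurableSet_ball ht.le ha0.le
    (hball p r hr hrr₀).le hlow
  have hroot : (t ^ a * (b * r ^ m)) ^ (1 / a) = t * (b ^ (1 / a) * r ^ (m / a)) := by
    rw [Real.mul_rpow (by positivity) (by positivity), Real.mul_rpow hb.le (by positivity),
      ← Real.rpow_mul ht.le, ← Real.rpow_mul hr.le, mul_one_div_cancel ha0.ne', Real.rpow_one,
      mul_one_div]
  have hcancel : b ^ (-(1 : ℝ) / a) * r ^ (-(m / a)) * (t ^ a * (b * r ^ m)) ^ (1 / a) = t := by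
    rw [hroot, neg_div, Real.rpow_neg hb.le, Real.rpow_neg hr.le]
    field_simp
  calc ENNReal.ofReal |u p| = ENNReal.ofReal (t + κ * r) := by rw [ht_def, sub_add_cancel]
    _ = ENNReal.ofReal t + ENNReal.ofReal (κ * r) := ENNReal.ofReal_add ht.le (by positivity)
    _ = ENNReal.ofReal (b ^ (-(1 : ℝ) / a) * r ^ (-(m / a))) *
          ENNReal.ofReal (t ^ a * (b * r ^ m)) ^ (1 / a) + ENNReal.ofReal (κ * r) := by
        rw [ENNReal.ofReal_rpow_of_nonneg (by positivity) (by positivity),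
          ← ENNReal.ofReal_mul (by positivity), hcancel]
    _ ≤ _ := by gcongr
end

section
/- For b ∈ ℝ define φ_b(t) = t^b Γ(t)/Γ(t+b). Then: (i) if 0 < b < 1, φ_b is strictly decreasing on (0, ∞); (ii) if b > 1, φ_b is strictly increasing on (0, ∞); (iii) if b < 0, φ_b is strictly increasing on (−b, ∞). -/
open Real

open Filter Topology in
/-- As `n → ∞`, `log Γ (x + n + 1)` is asymptotically `x log n + log n!`. -/
theorem tendsto_log_Gamma_add_nat_sub {x : ℝ} (hx : 0 < x) :
    Tendsto (fun n : ℕ ↦ log (Gamma (x + n + 1)) - (x * log n + log n.factorial)) atTop (𝓝 0) := by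
  have h := (BohrMollerup.tendsto_log_gamma hx).const_sub (log (Gamma x))
  rw [sub_self] at h
  refine h.congr fun n ↦ ?_
  have key := BohrMollerup.f_add_nat_eq (f := log ∘ Gamma) (fun {y} hy ↦ by
    simp only [Function.comp_apply]
    rw [Gamma_add_one hy.ne', log_mul hy.ne' (Gamma_pos_of_pos hy).ne', add_comm]) hx (n + 1)
  simp only [Function.comp_apply, Nat.cast_add, Nat.cast_one, ← add_assoc] at key
  rw [key, BohrMollerup.logGammaSeq]
  ring

/-- The logarithm of `t ^ b * Γ t / Γ (t + b)`. -/
noncomputable def logGammaRatio (b t : ℝ) : ℝ :=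
  b * log t + log (Gamma t) - log (Gamma (t + b))

theorem exp_logGammaRatio {b t : ℝ} (ht : 0 < t) (htb : 0 < t + b) :
    exp (logGammaRatio b t) = t ^ b * Gamma t / Gamma (t + b) := by
  rw [logGammaRatio, exp_sub, exp_add, exp_log (Gamma_pos_of_pos ht),
    exp_log (Gamma_pos_of_pos htb), rpow_def_of_pos ht, mul_comm b]

theorem logGammaRatio_sub_add_one {b t : ℝ} (ht : 0 < t) (htb : 0 < t + b) :
    logGammaRatio b t - logGammaRatio b (t + 1) =
      (b - 1) * log t - b * log (t + 1) + log (t + b) := by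
  rw [logGammaRatio, logGammaRatio, add_right_comm t 1 b, Gamma_add_one ht.ne',
    Gamma_add_one htb.ne', log_mul ht.ne' (Gamma_pos_of_pos ht).ne',
    log_mul htb.ne' (Gamma_pos_of_pos htb).ne']
  ring

open Filter Topology in
theorem tendsto_logGammaRatio_add_nat {b x : ℝ} (hx : 0 < x) (hxb : 0 < x + b) :
    Tendsto (fun n : ℕ ↦ logGammaRatio b (x + n)) atTop (𝓝 0) := by
  rw [← tendsto_add_atTop_iff_nat 1]
  have hlog := ((tendsto_log_comp_add_sub_log (x + 1)).comp
    (tendsto_natCast_atTop_atTop (R := ℝ))).const_mul b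
  have h := (hlog.add (tendsto_log_Gamma_add_nat_sub hx)).sub (tendsto_log_Gamma_add_nat_sub hxb)
  simp only [mul_zero, add_zero, sub_zero] at h
  refine h.congr fun n ↦ ?_
  simp only [logGammaRatio, Function.comp_apply, Nat.cast_add, Nat.cast_one]
  rw [show x + (n + 1 : ℝ) + b = x + b + n + 1 by ring,
    show x + (n + 1 : ℝ) = x + n + 1 by ring, show (n : ℝ) + (x + 1) = x + n + 1 by ring]
  ring

open Set in
theorem strictMonoOn_mul_log_combination {b a : ℝ} (ha : 0 < a) (hab : 0 < a + b)
    (hb : b * (b - 1) ≠ 0) :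
    StrictMonoOn (fun t ↦ b * (b - 1) * ((b - 1) * log t - b * log (t + 1) + log (t + b)))
      (Ici a) := by
  have hd : ∀ t ∈ Ici a, HasDerivAt
      (fun t ↦ b * (b - 1) * ((b - 1) * log t - b * log (t + 1) + log (t + b)))
      ((b * (b - 1)) ^ 2 / (t * (t + 1) * (t + b))) t := by
    intro t (hat : a ≤ t)
    have ht : 0 < t := by linarith
    have ht1 : 0 < t + 1 := by linarith
    have htb : 0 < t + b := by linarith
    refine HasDerivAt.congr_deriv ((((((hasDerivAt_id t).log ht.ne').const_mul (b - 1)).sub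
      ((((hasDerivAt_id t).add_const 1).log ht1.ne').const_mul b)).add
      (((hasDerivAt_id t).add_const b).log htb.ne')).const_mul (b * (b - 1))) ?_
    simp only [id]
    field_simp
    ring
  refine strictMonoOn_of_deriv_pos (convex_Ici a)
    (fun t ht ↦ (hd t ht).continuousAt.continuousWithinAt) fun t ht ↦ ?_
  have hat : a ≤ t := interior_subset ht
  rw [(hd t hat).deriv]
  have ht : 0 < t := by linarith
  have htb : 0 < t + b := by linarith
  positivity

theorem mul_logGammaRatio_lt {b s t : ℝ} (hs : 0 < s) (hsb : 0 < s + b) (hst : s < t)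
    (hb : b * (b - 1) ≠ 0) :
    b * (b - 1) * logGammaRatio b s < b * (b - 1) * logGammaRatio b t := by
  set D : ℕ → ℝ := fun n ↦
    b * (b - 1) * (logGammaRatio b (t + n) - logGammaRatio b (s + n)) with hD
  have hanti : StrictAnti D := by
    refine strictAnti_nat_of_succ_lt fun n ↦ ?_
    have hn : (0 : ℝ) ≤ n := n.cast_nonneg
    have hsn : s ≤ s + n := by linarith
    have htn : s ≤ t + n := by linarith
    have h := strictMonoOn_mul_log_combination hs hsb hb (Set.mem_Ici.2 hsn) (Set.mem_Ici.2 htn)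
      (by linarith)
    simp only at h
    rw [← logGammaRatio_sub_add_one (by linarith) (by linarith),
      ← logGammaRatio_sub_add_one (by linarith) (by linarith)] at h
    simp only [hD, Nat.cast_add, Nat.cast_one, ← add_assoc]
    linarith
  have hlim : Filter.Tendsto D Filter.atTop (nhds 0) := by
    simpa using ((tendsto_logGammaRatio_add_nat (hs.trans hst) (by linarith)).sub
      (tendsto_logGammaRatio_add_nat hs hsb)).const_mul (b * (b - 1))
  have h1 : 0 ≤ D 1 := hanti.antitone.le_of_tendsto hlim 1
  have h0 : 0 < D 0 := h1.trans_lt (hanti Nat.zero_lt_one)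
  simp only [hD, Nat.cast_zero, add_zero] at h0
  linarith

theorem stmt_9 (b : ℝ) :
    (0 < b → b < 1 →
      StrictAntiOn (fun t : ℝ => t ^ b * Real.Gamma t / Real.Gamma (t + b)) (Set.Ioi 0)) ∧
    (1 < b →
      StrictMonoOn (fun t : ℝ => t ^ b * Real.Gamma t / Real.Gamma (t + b)) (Set.Ioi 0)) ∧
    (b < 0 →
      StrictMonoOn (fun t : ℝ => t ^ b * Real.Gamma t / Real.Gamma (t + b)) (Set.Ioi (-b))) := by
  refine ⟨fun h0 h1 s hs t ht hst ↦ ?_, fun h1 s hs t ht hst ↦ ?_, fun h0 s hs t ht hst ↦ ?_⟩ <;>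
    rw [Set.mem_Ioi] at hs ht <;>
    dsimp only <;>
    rw [← exp_logGammaRatio (by linarith) (by linarith),
      ← exp_logGammaRatio (by linarith) (by linarith), exp_lt_exp]
  · have hb : b * (b - 1) < 0 := mul_neg_of_pos_of_neg h0 (by linarith)
    exact (mul_lt_mul_left_of_neg hb).1 (mul_logGammaRatio_lt hs (by linarith) hst hb.ne)
  · have hb : 0 < b * (b - 1) := mul_pos (by linarith) (by linarith)
    exact lt_of_mul_lt_mul_left (mul_logGammaRatio_lt hs (by linarith) hst hb.ne') hb.le
  · have hb : 0 < b * (b - 1) := mul_pos_of_neg_of_neg h0 (by linarith)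
    exact lt_of_mul_lt_mul_left
      (mul_logGammaRatio_lt (by linarith) (by linarith) hst hb.ne') hb.le
end

section
/- The function f(t) = (t − 1/2)(1 − log t) + log Γ(t), i.e. f(t) = log((e/t)^{t−1/2} Γ(t)), is strictly convex on (0, ∞), and f(t) tends to log √(2π/e) as t → +∞. -/
open Real Filter

/-- A function on the positive reals with a finite limit at infinity is strictly convex as soon as
its difference `f t - f (t + 1)` is. -/
theorem strictConvexOn_of_sub_add_one {f : ℝ → ℝ} {L : ℝ}
    (hf : StrictConvexOn ℝ (Set.Ioi 0) fun t => f t - f (t + 1))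
    (hL : Tendsto f atTop (nhds L)) : StrictConvexOn ℝ (Set.Ioi 0) f := by
  have hsum (n : ℕ) {x y a b : ℝ} (hx : 0 < x) (hy : 0 < y) (ha : 0 ≤ a) (hb : 0 ≤ b)
      (hab : a + b = 1) : f (a * x + b * y) - f (a * x + b * y + n) ≤
        a * (f x - f (x + n)) + b * (f y - f (y + n)) := by
    induction n with
    | zero => simp
    | succ n ih =>
      have h := hf.convexOn.2 (show x + n ∈ Set.Ioi 0 from by simp; positivity)
        (show y + n ∈ Set.Ioi 0 from by simp; positivity) ha hb hab
      have e : a • (x + n) + b • (y + n) = a * x + b * y + n := by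
        simp only [smul_eq_mul]; linear_combination (n : ℝ) * hab
      rw [e] at h
      simp only [smul_eq_mul] at h
      push_cast
      simp only [← add_assoc]
      linarith
  have hlim (t : ℝ) : Tendsto (fun n : ℕ => f t - f (t + n)) atTop (nhds (f t - L)) :=
    tendsto_const_nhds.sub
      (hL.comp (tendsto_atTop_add_const_left _ _ tendsto_natCast_atTop_atTop))
  have hconv : ∀ {x y a b : ℝ}, 0 < x → 0 < y → 0 ≤ a → 0 ≤ b → a + b = 1 →
      f (a * x + b * y) ≤ a * f x + b * f y := by
    intro x y a b hx hy ha hb hab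
    have h := le_of_tendsto_of_tendsto' (hlim (a * x + b * y))
      (((hlim x).const_mul a).add ((hlim y).const_mul b)) fun n => hsum n hx hy ha hb hab
    linear_combination h - L * hab
  refine ⟨convex_Ioi 0, fun x hx y hy hxy a b ha hb hab => ?_⟩
  have hx' : 0 < x := hx
  have hy' : 0 < y := hy
  have h₁ := hf.2 hx hy hxy ha hb hab
  have h₂ := hconv (show 0 < x + 1 by linarith) (show 0 < y + 1 by linarith) ha.le hb.le hab
  have e : a * (x + 1) + b * (y + 1) = a * x + b * y + 1 := by linear_combination hab
  rw [e] at h₂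
  simp only [smul_eq_mul] at h₁ ⊢
  linarith

theorem strictConvexOn_add_half_mul_log_sub_one :
    StrictConvexOn ℝ (Set.Ioi 0) fun t : ℝ => (t + 1 / 2) * (log (t + 1) - log t) - 1 := by
  have h₁ : ∀ t : ℝ, 0 < t → HasDerivAt (fun t : ℝ => (t + 1 / 2) * (log (t + 1) - log t) - 1)
      (log (t + 1) - log t + (t + 1 / 2) * ((t + 1)⁻¹ - t⁻¹)) t := by
    intro t ht
    have hl := (((hasDerivAt_id' t).add_const 1).log (by positivity)).sub
      ((hasDerivAt_id' t).log ht.ne')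
    exact ((((hasDerivAt_id' t).add_const (1 / 2 : ℝ)).mul hl).sub_const 1).congr_deriv (by simp)
  have h₂ : ∀ t : ℝ, 0 < t →
      HasDerivAt (fun t : ℝ => log (t + 1) - log t + (t + 1 / 2) * ((t + 1)⁻¹ - t⁻¹))
        (1 / (2 * t ^ 2 * (t + 1) ^ 2)) t := by
    intro t ht
    have hs := (hasDerivAt_id' t).add_const (1 : ℝ)
    have ht' : t + 1 ≠ 0 := by positivity
    have hl := (hs.log ht').sub ((hasDerivAt_id' t).log ht.ne')
    have hi := (hs.inv ht').sub ((hasDerivAt_id' t).inv ht.ne')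
    refine (hl.add (((hasDerivAt_id' t).add_const (1 / 2 : ℝ)).mul hi)).congr_deriv ?_
    simp only [Pi.sub_apply, Pi.inv_apply]
    field_simp
    ring
  refine strictConvexOn_of_deriv2_pos' (convex_Ioi 0)
    (fun t ht => (h₁ t ht).continuousAt.continuousWithinAt) fun t ht => ?_
  have ht' : 0 < t := ht
  have he : deriv (fun t : ℝ => (t + 1 / 2) * (log (t + 1) - log t) - 1) =ᶠ[nhds t]
      fun t : ℝ => log (t + 1) - log t + (t + 1 / 2) * ((t + 1)⁻¹ - t⁻¹) := by
    filter_upwards [Ioi_mem_nhds ht'] with s hs using (h₁ s hs).deriv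
  simp only [Function.iterate_succ, Function.iterate_zero, Function.comp_apply, id]
  rw [he.deriv_eq, (h₂ t ht').deriv]
  positivity

theorem tendsto_log_Gamma_stirling_nat :
    Tendsto (fun n : ℕ => ((n : ℝ) - 1 / 2) * (1 - log n) + log (Gamma n)) atTop
      (nhds (log √(2 * π / exp 1))) := by
  have h := ((continuousAt_log (by positivity : √π ≠ 0)).tendsto.comp
    Stirling.tendsto_stirlingSeq_sqrt_pi).add_const (1 / 2 * log 2 - 1 / 2)
  have e : log √(2 * π / exp 1) = log √π + (1 / 2 * log 2 - 1 / 2) := by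
    rw [log_sqrt (by positivity), log_sqrt (by positivity), log_div (by positivity) (by positivity),
      log_mul (by positivity) (by positivity), log_exp]
    ring
  rw [e]
  refine h.congr' ?_
  filter_upwards [eventually_gt_atTop 0] with n hn
  have hn' : (0 : ℝ) < n := by exact_mod_cast hn
  have hG : log (n.factorial : ℝ) = log n + log (Gamma n) := by
    rw [← Gamma_nat_eq_factorial, Gamma_add_one hn'.ne',
      log_mul hn'.ne' (Gamma_pos_of_pos hn').ne']
  rw [Function.comp_apply, Stirling.log_stirlingSeq_formula, hG, log_mul two_ne_zero hn'.ne',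
    log_div hn'.ne' (exp_pos 1).ne', log_exp]
  ring

theorem abs_log_Gamma_stirling_nat_add_sub_le {n : ℕ} (hn : 2 ≤ n) {x : ℝ} (hx₀ : 0 ≤ x)
    (hx₁ : x ≤ 1) :
    |((n + x - 1 / 2) * (1 - log (n + x)) + log (Gamma (n + x))) -
      (((n : ℝ) - 1 / 2) * (1 - log n) + log (Gamma n))| ≤ 2 / ((n : ℝ) - 1) := by
  have hn' : (2 : ℝ) ≤ n := by exact_mod_cast hn
  have hn₀ : (0 : ℝ) < n := by linarith
  have hn₁ : (0 : ℝ) < n - 1 := by linarith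
  rcases hx₀.eq_or_lt with rfl | hx
  · simpa using by positivity
  have hfeq : ∀ {y : ℝ}, 0 < y → (log ∘ Gamma) (y + 1) = (log ∘ Gamma) y + log y := by
    intro y hy
    simp only [Function.comp_apply]
    rw [Gamma_add_one hy.ne', log_mul hy.ne' (Gamma_pos_of_pos hy).ne', add_comm]
  have hle := BohrMollerup.f_add_nat_le convexOn_log_Gamma hfeq (by omega : n ≠ 0) hx hx₁
  have hge := BohrMollerup.f_add_nat_ge convexOn_log_Gamma hfeq hn hx
  simp only [Function.comp_apply] at hle hge
  have hlog_ge : x / (n + x) ≤ log (n + x) - log n := by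
    rw [← log_div (by positivity) (by positivity)]
    refine le_trans (le_of_eq ?_) (one_sub_inv_le_log_of_pos (by positivity))
    field_simp
    ring
  have hlog_le : log (n + x) - log n ≤ x / n := by
    rw [← log_div (by positivity) (by positivity)]
    refine (log_le_sub_one_of_pos (by positivity)).trans (le_of_eq ?_)
    field_simp
    ring
  have hlog_pred : -(1 / ((n : ℝ) - 1)) ≤ log ((n : ℝ) - 1) - log n := by
    rw [← log_div (by positivity) (by positivity)]
    refine le_trans (le_of_eq ?_) (one_sub_inv_le_log_of_pos (by positivity))
    field_simp
    ring
  have hinv : 1 / (n : ℝ) ≤ 1 / ((n : ℝ) - 1) := by gcongr; linarith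
  have htwo : 2 / ((n : ℝ) - 1) = 1 / ((n : ℝ) - 1) + 1 / ((n : ℝ) - 1) := by ring
  have hpos : 0 < 1 / ((n : ℝ) - 1) := by positivity
  rw [abs_le]
  constructor
  · have h₁ := mul_le_mul_of_nonneg_left hlog_le (by linarith : (0 : ℝ) ≤ n + x - 1 / 2)
    have h₂ := mul_le_mul_of_nonneg_left hlog_pred hx₀
    have h₃ : (n + x - 1 / 2) * (x / n) ≤ x + 1 / n := by
      rw [mul_div_assoc', div_le_iff₀ hn₀, add_mul, div_mul_cancel₀ _ hn₀.ne']
      nlinarith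
    have h₄ : x * (1 / ((n : ℝ) - 1)) ≤ 1 / ((n : ℝ) - 1) := by nlinarith
    linarith
  · have h₁ := mul_le_mul_of_nonneg_left hlog_ge (by linarith : (0 : ℝ) ≤ n + x - 1 / 2)
    have h₃ : x - 1 / n ≤ (n + x - 1 / 2) * (x / (n + x)) := by
      have : (n + x - 1 / 2) * (x / (n + x)) = x - x / 2 / (n + x) := by field_simp
      rw [this]
      have : x / 2 / (n + x) ≤ 1 / n := by gcongr <;> linarith
      linarith
    linarith

theorem tendsto_log_Gamma_stirling :
    Tendsto (fun t : ℝ => (t - 1 / 2) * (1 - log t) + log (Gamma t)) atTop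
      (nhds (log √(2 * π / exp 1))) := by
  have hnat := tendsto_log_Gamma_stirling_nat.comp (tendsto_nat_floor_atTop (α := ℝ))
  have hbound : Tendsto (fun n : ℕ => 2 / ((n : ℝ) - 1)) atTop (nhds 0) :=
    tendsto_const_nhds.div_atTop
      (tendsto_atTop_add_const_right _ _ tendsto_natCast_atTop_atTop)
  have hdiff := squeeze_zero_norm' (f := fun t : ℝ =>
      ((t - 1 / 2) * (1 - log t) + log (Gamma t)) -
        (((⌊t⌋₊ : ℝ) - 1 / 2) * (1 - log ⌊t⌋₊) + log (Gamma ⌊t⌋₊))) (by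
    filter_upwards [eventually_ge_atTop 2] with t ht
    have h := abs_log_Gamma_stirling_nat_add_sub_le (n := ⌊t⌋₊) (x := t - ⌊t⌋₊)
      (Nat.le_floor (by exact_mod_cast ht)) (sub_nonneg.2 (Nat.floor_le (by linarith)))
      (by linarith [Nat.lt_floor_add_one t])
    rwa [add_sub_cancel] at h) (hbound.comp (tendsto_nat_floor_atTop (α := ℝ)))
  simpa using hdiff.add hnat

theorem stmt_11 :
    StrictConvexOn ℝ (Set.Ioi (0 : ℝ))
        (fun t : ℝ => (t - 1 / 2) * (1 - Real.log t) + Real.log (Real.Gamma t)) ∧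
      Filter.Tendsto (fun t : ℝ => (t - 1 / 2) * (1 - Real.log t) + Real.log (Real.Gamma t))
        Filter.atTop (nhds (Real.log (Real.sqrt (2 * Real.pi / Real.exp 1)))) := by
  refine ⟨strictConvexOn_of_sub_add_one ?_ tendsto_log_Gamma_stirling, tendsto_log_Gamma_stirling⟩
  refine strictConvexOn_add_half_mul_log_sub_one.congr fun t ht => ?_
  have ht' : 0 < t := ht
  simp only
  rw [Gamma_add_one ht'.ne', log_mul ht'.ne' (Gamma_pos_of_pos ht').ne']
  ring
end

section
/- For every real t > 0, ∑_{n=0}^{∞} 1/(t+n)² > 1/t + 1/(2t²). -/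
open Filter Topology in
/-- The increments of `x ↦ 1 / x + 1 / (2 * x ^ 2)` along `t + ℕ` telescope. -/
lemma hasSum_telescope_one_div_add_one_div_two_mul_sq {t : ℝ} (ht : 0 < t) :
    HasSum (fun n : ℕ ↦ (1 / (t + n) + 1 / (2 * (t + n) ^ 2)) -
      (1 / (t + (n + 1 : ℕ)) + 1 / (2 * (t + (n + 1 : ℕ)) ^ 2))) (1 / t + 1 / (2 * t ^ 2)) := by
  rw [hasSum_iff_tendsto_nat_of_nonneg]
  · have hsum (N : ℕ) := Finset.sum_range_sub'
      (fun n : ℕ ↦ 1 / (t + n) + 1 / (2 * (t + n) ^ 2)) N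
    simp only [hsum]
    have hlin : Tendsto (fun n : ℕ ↦ t + (n : ℝ)) atTop atTop :=
      tendsto_atTop_add_const_left _ _ tendsto_natCast_atTop_atTop
    have hinv : Tendsto (fun n : ℕ ↦ (t + (n : ℝ))⁻¹) atTop (𝓝 0) :=
      tendsto_inv_atTop_zero.comp hlin
    have hlim := tendsto_const_nhds (x := 1 / t + 1 / (2 * t ^ 2)) |>.sub
      (hinv.add ((hinv.pow 2).const_mul (1 / 2)))
    convert hlim using 1
    · ext n
      simp [mul_comm]
    · simp
  · intro n
    have hn : 0 < t + n := by positivity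
    rw [sub_nonneg]
    gcongr <;> simp

/-- The trapezoid bound for one step of the sum of `1 / x ^ 2`. -/
lemma sub_lt_one_div_sq {x : ℝ} (hx : 0 < x) :
    (1 / x + 1 / (2 * x ^ 2)) - (1 / (x + 1) + 1 / (2 * (x + 1) ^ 2)) < 1 / x ^ 2 := by
  have h : 1 / x ^ 2 = (1 / x + 1 / (2 * x ^ 2)) - (1 / (x + 1) + 1 / (2 * (x + 1) ^ 2)) +
      1 / (2 * x ^ 2 * (x + 1) ^ 2) := by
    field_simp
    ring
  have hpos : 0 < 1 / (2 * x ^ 2 * (x + 1) ^ 2) := by positivity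
  linarith

lemma summable_one_div_add_nat_sq (t : ℝ) : Summable (fun n : ℕ ↦ 1 / (t + n) ^ 2) := by
  have h := (Real.summable_one_div_nat_add_rpow t 2).2 one_lt_two
  simpa [add_comm] using h

theorem stmt_13 (t : ℝ) (ht : 0 < t) :
    1 / t + 1 / (2 * t ^ 2) < ∑' n : ℕ, 1 / (t + n) ^ 2 := by
  have hstep (n : ℕ) : (1 / (t + n) + 1 / (2 * (t + n) ^ 2)) -
      (1 / (t + (n + 1 : ℕ)) + 1 / (2 * (t + (n + 1 : ℕ)) ^ 2)) < 1 / (t + n) ^ 2 := by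
    have h := sub_lt_one_div_sq (x := t + n) (by positivity)
    simpa only [Nat.cast_add, Nat.cast_one, add_assoc] using h
  exact hasSum_lt (fun n ↦ (hstep n).le) (hstep 0)
    (hasSum_telescope_one_div_add_one_div_two_mul_sq ht) (summable_one_div_add_nat_sq t).hasSum
end

section
/- For every real a > 0: (2/e)^{1/(2a)} · √((a+1)/e) < (2^{a/2} Γ((a+1)/2)/√π)^{1/a} < √((a+1)/e). -/
open Real

open Filter Topology in
theorem StrictAnti.lt_of_tendsto {α : Type*} [TopologicalSpace α] [Preorder α]
    [OrderClosedTopology α] {u : ℕ → α} {l : α} (hu : StrictAnti u)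
    (hl : Tendsto u atTop (𝓝 l)) (n : ℕ) : l < u n :=
  (hu.antitone.le_of_tendsto hl (n + 1)).trans_lt (hu n.lt_succ_self)

/-- The remainder in the approximation of `log (Gamma t)` by `(t - 1 / 2) * (log t - 1)`. -/
noncomputable def logGammaRemainder (t : ℝ) : ℝ :=
  log (Gamma t) - (t - 1 / 2) * (log t - 1)

theorem hasSum_add_half_mul_log_one_add_inv {t : ℝ} (ht : 0 < t) :
    HasSum (fun k : ℕ ↦ 1 / (2 * (k : ℝ) + 1) * (1 / (2 * t + 1)) ^ (2 * k))
      ((t + 1 / 2) * log (1 + t⁻¹)) := by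
  convert! (hasSum_log_one_add_inv ht).mul_left (t + 1 / 2) using 1
  ext k
  rw [pow_succ]
  field_simp

theorem one_lt_add_half_mul_log_one_add_inv {t : ℝ} (ht : 0 < t) :
    1 < (t + 1 / 2) * log (1 + t⁻¹) := by
  have h := hasSum_add_half_mul_log_one_add_inv ht
  have hle := h.summable.sum_le_tsum (Finset.range 2) (fun k _ ↦ by positivity)
  rw [h.tsum_eq, Finset.sum_range_succ, Finset.sum_range_one] at hle
  have hpos : (0 : ℝ) < 1 / (2 * ((1 : ℕ) : ℝ) + 1) * (1 / (2 * t + 1)) ^ (2 * 1) := by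
    positivity
  simp only [Nat.cast_zero, mul_zero, zero_add, pow_zero, div_one, mul_one] at hle hpos
  linarith

theorem add_half_mul_log_one_add_inv_lt {s t : ℝ} (hs : 0 < s) (hst : s < t) :
    (t + 1 / 2) * log (1 + t⁻¹) < (s + 1 / 2) * log (1 + s⁻¹) := by
  have ht := hs.trans hst
  refine hasSum_lt (i := 1) (fun k ↦ ?_) ?_ (hasSum_add_half_mul_log_one_add_inv ht)
    (hasSum_add_half_mul_log_one_add_inv hs)
  · gcongr
  · gcongr

theorem logGammaRemainder_sub_add_one {t : ℝ} (ht : 0 < t) :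
    logGammaRemainder t - logGammaRemainder (t + 1) = (t + 1 / 2) * log (1 + t⁻¹) - 1 := by
  have hinv : 1 + t⁻¹ = (t + 1) / t := by field_simp
  rw [logGammaRemainder, logGammaRemainder, Gamma_add_one ht.ne',
    log_mul ht.ne' (Gamma_pos_of_pos ht).ne', hinv, log_div (by positivity) ht.ne']
  ring

theorem log_Gamma_add_nat {t : ℝ} (ht : 0 < t) (n : ℕ) :
    log (Gamma (t + n)) = log (Gamma t) + ∑ m ∈ Finset.range n, log (t + m) := by
  refine BohrMollerup.f_add_nat_eq (f := fun x ↦ log (Gamma x)) (fun {y} hy ↦ ?_) ht n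
  rw [Gamma_add_one hy.ne', log_mul hy.ne' (Gamma_pos_of_pos hy).ne', add_comm]

open Filter Topology in
theorem tendsto_logGammaRemainder_add_nat {t : ℝ} (ht : 0 < t) :
    Tendsto (fun n : ℕ ↦ logGammaRemainder (t + n)) atTop (𝓝 ((log 2 + log π - 1) / 2)) := by
  rw [← tendsto_add_atTop_iff_nat 1]
  have hG := BohrMollerup.tendsto_log_gamma ht
  have hS := (Stirling.tendsto_stirlingSeq_sqrt_pi).log (by positivity)
  have hL : Tendsto (fun n : ℕ ↦ (n : ℝ) * log (1 + (t + 1) / n)) atTop (𝓝 (t + 1)) :=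
    (tendsto_mul_log_one_add_div_atTop (t + 1)).comp tendsto_natCast_atTop_atTop
  have hZ : Tendsto (fun n : ℕ ↦ log (1 + (t + 1) / n)) atTop (𝓝 (log (1 + 0))) :=
    ((tendsto_const_div_atTop_nhds_zero_nat (t + 1)).const_add 1).log (by norm_num)
  have key := (((hS.sub hG).add_const (log (Gamma t) + log 2 / 2 + t + 1 / 2)).sub hL).sub
    (hZ.const_mul (t + 1 / 2))
  have hlim : log √π - log (Gamma t) + (log (Gamma t) + log 2 / 2 + t + 1 / 2) - (t + 1)
      - (t + 1 / 2) * log (1 + 0) = (log 2 + log π - 1) / 2 := by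
    rw [log_sqrt pi_pos.le, add_zero, log_one]
    ring
  rw [hlim] at key
  refine key.congr' ?_
  filter_upwards [eventually_gt_atTop 0] with n hn
  have hn' : (0 : ℝ) < n := Nat.cast_pos.mpr hn
  have hsum : 1 + (t + 1) / n = (t + (n + 1 : ℕ)) / n := by
    push_cast
    field_simp
    ring
  rw [logGammaRemainder, log_Gamma_add_nat ht, BohrMollerup.logGammaSeq,
    Stirling.log_stirlingSeq_formula, hsum, log_div (by positivity) hn'.ne',
    log_div hn'.ne' (exp_ne_zero 1), log_exp, log_mul two_ne_zero hn'.ne']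
  push_cast
  ring

theorem strictAnti_logGammaRemainder_add_nat {t : ℝ} (ht : 0 < t) :
    StrictAnti (fun n : ℕ ↦ logGammaRemainder (t + n)) := by
  refine strictAnti_nat_of_succ_lt fun n ↦ ?_
  have hpos : 0 < t + n := by positivity
  have h := logGammaRemainder_sub_add_one hpos
  have h' := one_lt_add_half_mul_log_one_add_inv hpos
  push_cast
  rw [← add_assoc]
  linarith

theorem lt_logGammaRemainder {t : ℝ} (ht : 0 < t) :
    (log 2 + log π - 1) / 2 < logGammaRemainder t := by
  simpa using (strictAnti_logGammaRemainder_add_nat ht).lt_of_tendsto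
    (tendsto_logGammaRemainder_add_nat ht) 0

theorem strictAntiOn_logGammaRemainder : StrictAntiOn logGammaRemainder (Set.Ioi 0) := by
  intro s hs t ht hst
  rw [Set.mem_Ioi] at hs ht
  have hanti : StrictAnti
      (fun n : ℕ ↦ logGammaRemainder (s + n) - logGammaRemainder (t + n)) := by
    refine strictAnti_nat_of_succ_lt fun n ↦ ?_
    have hs' : 0 < s + n := by positivity
    have ht' : 0 < t + n := by positivity
    have h := add_half_mul_log_one_add_inv_lt hs' (show s + n < t + n by linarith)
    have h₁ := logGammaRemainder_sub_add_one hs'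
    have h₂ := logGammaRemainder_sub_add_one ht'
    push_cast
    rw [← add_assoc, ← add_assoc]
    linarith
  have h := hanti.lt_of_tendsto ((tendsto_logGammaRemainder_add_nat hs).sub
    (tendsto_logGammaRemainder_add_nat ht)) 0
  simpa using h

theorem logGammaRemainder_one_half : logGammaRemainder (1 / 2) = log π / 2 := by
  rw [logGammaRemainder, Gamma_one_half_eq, log_sqrt pi_pos.le]
  ring

theorem stmt_14 (a : ℝ) (ha : 0 < a) :
    (2 / Real.exp 1) ^ (1 / (2 * a)) * Real.sqrt ((a + 1) / Real.exp 1)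
        < (2 ^ (a / 2) * Real.Gamma ((a + 1) / 2) / Real.sqrt Real.pi) ^ (1 / a) ∧
      (2 ^ (a / 2) * Real.Gamma ((a + 1) / 2) / Real.sqrt Real.pi) ^ (1 / a)
        < Real.sqrt ((a + 1) / Real.exp 1) := by
  have ha1 : 0 < a + 1 := by positivity
  have hG : 0 < Gamma ((a + 1) / 2) := Gamma_pos_of_pos (by positivity)
  have hlower := lt_logGammaRemainder (t := (a + 1) / 2) (by positivity)
  have hupper := strictAntiOn_logGammaRemainder (a := 1 / 2) (b := (a + 1) / 2)
    (Set.mem_Ioi.mpr (by norm_num)) (Set.mem_Ioi.mpr (by positivity)) (by linarith)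
  rw [logGammaRemainder_one_half] at hupper
  rw [logGammaRemainder, log_div ha1.ne' two_ne_zero] at hlower hupper
  have hsqrt : log √((a + 1) / exp 1) = (log (a + 1) - 1) / 2 := by
    rw [log_sqrt (by positivity), log_div ha1.ne' (exp_ne_zero 1), log_exp]
  have hmid : log ((2 ^ (a / 2) * Gamma ((a + 1) / 2) / √π) ^ (1 / a)) =
      (a / 2 * log 2 + log (Gamma ((a + 1) / 2)) - log π / 2) / a := by
    rw [log_rpow (by positivity), log_div (by positivity) (by positivity),
      log_mul (by positivity) hG.ne', log_rpow two_pos, log_sqrt pi_pos.le]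
    ring
  have hleft : log ((2 / exp 1) ^ (1 / (2 * a)) * √((a + 1) / exp 1)) =
      ((log 2 - 1) / 2 + a * ((log (a + 1) - 1) / 2)) / a := by
    rw [log_mul (by positivity) (by positivity), hsqrt, log_rpow (by positivity),
      log_div two_ne_zero (exp_ne_zero 1), log_exp]
    field_simp
  constructor
  · rw [← log_lt_log_iff (by positivity) (by positivity), hleft, hmid]
    gcongr
    linarith
  · rw [← log_lt_log_iff (by positivity) (by positivity), hsqrt, hmid, div_lt_iff₀ ha]
    linarith
end
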